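/- Up to the action of the isometry group O(L_M), there is exactly one primitive embedding of D12^+(−2) into the Mukai lattice L_M, and the orthogonal complement of its image is isometric to U(2)^4 ⊕ ⟨−2⟩^4. -/

import Mathlib

open Matrix Module

/-- The bilinear form on `ι → ℤ` associated to a Gram matrix. -/
def gramBilin {ι : Type*} [Fintype ι] (G : Matrix ι ι ℤ) :
    (ι → ℤ) →ₗ[ℤ] (ι → ℤ) →ₗ[ℤ] ℤ :=
  LinearMap.mk₂ ℤ (fun x y => x ⬝ᵥ (G *ᵥ y))
    (fun x x' y => add_dotProduct x x' (G *ᵥ y))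
    (fun c x y => smul_dotProduct c x (G *ᵥ y))
    (fun x y y' => by show x ⬝ᵥ (G *ᵥ (y + y')) = _; rw [Matrix.mulVec_add, dotProduct_add])
    (fun c x y => by show x ⬝ᵥ (G *ᵥ (c • y)) = _; rw [Matrix.mulVec_smul, dotProduct_smul])

/-- The orthogonal complement of a submodule with respect to a bilinear form. -/
def orthSub {M : Type*} [AddCommGroup M] (b : M →ₗ[ℤ] M →ₗ[ℤ] ℤ)
    (T : Submodule ℤ M) : Submodule ℤ M where
  carrier := {x | ∀ y ∈ T, b x y = 0}
  add_mem' := by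
    intro a c ha hc y hy
    simp only [Set.mem_setOf_eq] at *
    rw [map_add, LinearMap.add_apply, ha y hy, hc y hy, add_zero]
  zero_mem' := by intro y hy; simp
  smul_mem' := by
    intro k x hx y hy
    simp only [Set.mem_setOf_eq] at hx
    rw [_root_.map_smul, LinearMap.smul_apply, hx y hy, smul_zero]

/-- The E8 Cartan matrix (Bourbaki numbering). -/
def E8M : Matrix (Fin 8) (Fin 8) ℤ :=
  !![2,0,-1,0,0,0,0,0;
     0,2,0,-1,0,0,0,0;
     -1,0,2,-1,0,0,0,0;
     0,-1,-1,2,-1,0,0,0;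
     0,0,0,-1,2,-1,0,0;
     0,0,0,0,-1,2,-1,0;
     0,0,0,0,0,-1,2,-1;
     0,0,0,0,0,0,-1,2]

/-- Index type for the Mukai lattice `L_M = U^4 ⊕ E8(-1)^2`. -/
abbrev MukaiIx : Type := (Fin 4 × Fin 2) ⊕ (Fin 2 × Fin 8)

/-- The underlying module of the Mukai lattice. -/
abbrev LM : Type := MukaiIx → ℤ

/-- The Gram matrix of the Mukai lattice `U^4 ⊕ E8(-1)^2`. -/
def GLM : Matrix MukaiIx MukaiIx ℤ :=
  Matrix.of fun p q =>
    match p, q with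
    | .inl (i, a), .inl (j, b) => if i = j ∧ a ≠ b then 1 else 0
    | .inr (i, a), .inr (j, b) => if i = j then -(E8M a b) else 0
    | _, _ => 0

/-- The bilinear form of the Mukai lattice. -/
def bLM : LM →ₗ[ℤ] LM →ₗ[ℤ] ℤ := gramBilin GLM

/-- The lattice `D12`, realised inside `ℚ^12`: integral vectors with even
coordinate sum. -/
def D12set : Set (Fin 12 → ℚ) :=
  {x | (∀ i, ∃ k : ℤ, x i = k) ∧ (∃ m : ℤ, ∑ i, x i = 2 * m)}

/-- The odd unimodular overlattice `D12^+ = D12 + ℤ·(1/2,…,1/2)` of `D12`. -/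
def D12plus : Submodule ℤ (Fin 12 → ℚ) :=
  Submodule.span ℤ (D12set ∪ {fun _ => (1 : ℚ) / 2})

/-- A primitive embedding of `D12^+(-2)` into the Mukai lattice. -/
def IsPrimD12Embedding (ι : ↥D12plus →ₗ[ℤ] LM) : Prop :=
  Function.Injective ι ∧
  (∀ s s' : ↥D12plus,
    (bLM (ι s) (ι s') : ℚ) = -2 * ∑ i, (s : Fin 12 → ℚ) i * (s' : Fin 12 → ℚ) i) ∧
  (∀ (x : LM) (k : ℤ), k ≠ 0 → k • x ∈ LinearMap.range ι → x ∈ LinearMap.range ι)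

/-- Index type for the lattice `U(2)^4 ⊕ ⟨-2⟩^4`. -/
abbrev T0Ix : Type := (Fin 4 × Fin 2) ⊕ Fin 4

/-- The Gram matrix of `U(2)^4 ⊕ ⟨-2⟩^4`. -/
def GT0 : Matrix T0Ix T0Ix ℤ :=
  Matrix.of fun p q =>
    match p, q with
    | .inl (i, a), .inl (j, b) => if i = j ∧ a ≠ b then 2 else 0
    | .inr i, .inr j => if i = j then -2 else 0
    | _, _ => 0


/-- orthogonal frame -/
structure IsFrame {V J : Type*} [AddCommGroup V] [Module ℚ V] [DecidableEq J]
    (B : V →ₗ[ℚ] V →ₗ[ℚ] ℚ) (e : J → V) (sg : J → ℚ) : Prop where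
  gram : ∀ i j, B (e i) (e j) = if i = j then sg i else 0
  span : ∀ x, (∀ i, B x (e i) = 0) → x = 0

/-- reflection -/
def rfn {V : Type*} [AddCommGroup V] [Module ℚ V] (B : V →ₗ[ℚ] V →ₗ[ℚ] ℚ) (z y : V) : V :=
  y - (2 * B y z / B z z) • z

lemma rfn_iso {V : Type*} [AddCommGroup V] [Module ℚ V] (B : V →ₗ[ℚ] V →ₗ[ℚ] ℚ)
    (hs : ∀ x y, B x y = B y x) (z : V) (hz : B z z ≠ 0) (x y : V) :
    B (rfn B z x) (rfn B z y) = B x y := by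
  simp only [rfn, map_sub, LinearMap.sub_apply, map_smul, LinearMap.smul_apply, smul_eq_mul]
  rw [hs z y]
  field_simp
  ring

lemma rfn_rfn {V : Type*} [AddCommGroup V] [Module ℚ V] (B : V →ₗ[ℚ] V →ₗ[ℚ] ℚ)
    (z : V) (hz : B z z ≠ 0) (x : V) :
    rfn B z (rfn B z x) = x := by
  simp only [rfn, map_sub, LinearMap.sub_apply, map_smul, LinearMap.smul_apply, smul_eq_mul]
  rw [sub_sub, ← add_smul]
  have : (2 * (B x) z / (B z) z + 2 * ((B x) z - 2 * (B x) z / (B z) z * (B z) z) / (B z) z) = 0 := by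
    field_simp
    ring
  rw [this]; simp

lemma rfn_fix {V : Type*} [AddCommGroup V] [Module ℚ V] (B : V →ₗ[ℚ] V →ₗ[ℚ] ℚ)
    (z : V) (x : V) (h : B x z = 0) : rfn B z x = x := by
  simp [rfn, h]

lemma IsFrame.rfn {V J : Type*} [AddCommGroup V] [Module ℚ V] [DecidableEq J]
    {B : V →ₗ[ℚ] V →ₗ[ℚ] ℚ} (hs : ∀ x y, B x y = B y x) {e : J → V} {sg : J → ℚ}
    (h : IsFrame B e sg) (z : V) (hz : B z z ≠ 0) : IsFrame B (fun i => rfn B z (e i)) sg := by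
  constructor
  · intro i j
    rw [rfn_iso B hs z hz, h.gram]
  · intro x hx
    have : _root_.rfn B z x = 0 := by
      apply h.span
      intro i
      rw [← rfn_iso B hs z hz, rfn_rfn B z hz, hx]
    rw [← rfn_rfn B z hz x, this]; simp [_root_.rfn]

lemma witt {V J : Type*} [AddCommGroup V] [Module ℚ V] [DecidableEq J]
    {B : V →ₗ[ℚ] V →ₗ[ℚ] ℚ} (hs : ∀ x y, B x y = B y x) {e : J → V} {sg : J → ℚ}
    (h : IsFrame B e sg) (hsg : ∀ i, sg i ≠ 0) (I : J → Prop) (k : J) (hk : ¬ I k)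
    (x : V) (hx : B x x = sg k) (hxI : ∀ i, I i → B x (e i) = 0) :
    ∃ e' : J → V, IsFrame B e' sg ∧ (∀ i, I i → e' i = e i) ∧ e' k = x := by
  have hek : B (e k) (e k) = sg k := by simp [h.gram]
  have hekI : ∀ i, I i → B (e i) (e k) = 0 := by
    intro i hi
    rw [h.gram, if_neg]
    rintro rfl; exact hk hi
  by_cases hz : B (e k - x) (e k - x) = 0
  · have hp : B (e k + x) (e k + x) = 4 * sg k := by
      simp only [map_sub, map_add, LinearMap.sub_apply, LinearMap.add_apply] at hz ⊢
      rw [hs x (e k)] at *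
      linarith
    have hp0 : B (e k + x) (e k + x) ≠ 0 := by rw [hp]; simpa using hsg k
    have h1 := h.rfn hs _ hp0
    have hx0 : B x x ≠ 0 := by rw [hx]; exact hsg k
    refine ⟨_, h1.rfn hs x hx0, ?_, ?_⟩
    · intro i hi
      rw [rfn_fix B _ (e i), rfn_fix B _ (e i)]
      · rw [hs]; exact hxI i hi
      · rw [map_add, hekI i hi, hs, hxI i hi, add_zero]
    · have : rfn B (e k + x) (e k) = -x := by
        have hc : B (e k) (e k + x) = 2 * sg k := by
          simp only [map_sub, map_add, LinearMap.sub_apply, LinearMap.add_apply] at hz ⊢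
          rw [hs x (e k)] at hz
          linarith
        have := hsg k
        rw [rfn, hp, hc]
        rw [show 2 * (2 * sg k) / (4 * sg k) = 1 by field_simp; norm_num]
        simp
      rw [this, rfn]
      simp only [map_neg, LinearMap.neg_apply]
      rw [show 2 * -(B x x) / (B x x) = -2 by field_simp]
      module
  · refine ⟨_, h.rfn hs _ hz, ?_, ?_⟩
    · intro i hi
      rw [rfn_fix B _ (e i)]
      rw [map_sub, hekI i hi, hs, hxI i hi, sub_zero]
    ·
      have : 2 * B (e k) (e k - x) = B (e k - x) (e k - x) := by
        simp only [map_sub, LinearMap.sub_apply]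
        rw [hs x (e k)]; linarith
      rw [rfn, this, div_self hz]; simp

/-- signs -/
def epsv : Fin 12 → ℤ := ![1, 1, 1, -1, -1, -1, -1, -1, -1, -1, -1, 1]

lemma epsv_sq (i : Fin 12) : epsv i * epsv i = 1 := by revert i; decide

lemma epsv_odd (i : Fin 12) : epsv i % 2 = 1 := by revert i; decide

/-- partial state -/
structure PState {N V A : Type*} [AddCommGroup N] [AddCommGroup V] [Module ℚ V] [DecidableEq A]
    (β : N →ₗ[ℤ] N →ₗ[ℤ] ℤ) (B : V →ₗ[ℚ] V →ₗ[ℚ] ℚ) (j : N →+ V) (a : A → V) (s : Fin 12 → N)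
    (k : ℕ) (t : Fin 12 → N) (e : A ⊕ Fin 12 → V) : Prop where
  cong : ∀ i, ∃ u, t i = s i + (2 : ℤ) • u
  orth : ∀ i i', i.val < k → β (t i) (t i') = if i = i' then epsv i else 0
  frame : IsFrame B e (Sum.elim (fun _ => -1) (fun i => (epsv i : ℚ)))
  ea : ∀ i, e (Sum.inl i) = a i
  et : ∀ i, i.val < k → e (Sum.inr i) = j (t i)

lemma proj_ex {N : Type*} [AddCommGroup N] (β : N →ₗ[ℤ] N →ₗ[ℤ] ℤ)
    (t : Fin 12 → N) (k : ℕ)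
    (orth : ∀ i i', i.val < k → β (t i) (t i') = if i = i' then epsv i else 0) (x : N) :
    ∃ x', (∀ i, i.val < k → β x' (t i) = 0) ∧
      ∀ v, (∀ i, i.val < k → β v (t i) = 0) → β v x' = β v x := by
  refine ⟨x - ∑ i with i.val < k, (epsv i * β x (t i)) • t i, ?_, ?_⟩
  · intro i hi
    rw [map_sub, LinearMap.sub_apply, map_sum, LinearMap.sum_apply, sub_eq_zero]
    rw [Finset.sum_eq_single_of_mem i (by simpa using hi)]
    · rw [map_smul, LinearMap.smul_apply, orth i i hi, if_pos rfl, smul_eq_mul]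
      linear_combination (- β x (t i)) * epsv_sq i
    · intro b hb hne
      rw [map_smul, LinearMap.smul_apply, orth b i (by simpa using hb), if_neg hne, smul_zero]
  · intro v hv
    rw [map_sub, map_sum, Finset.sum_eq_zero, sub_zero]
    intro i hi
    rw [map_smul, hv i (by simpa using hi), smul_zero]

/-- find a good isotropic vector -/
lemma good_iso {N : Type*} [AddCommGroup N] (β : N →ₗ[ℤ] N →ₗ[ℤ] ℤ)
    (hs : ∀ x y, β x y = β y x)
    (P : ∀ v, v ≠ 0 → ∃ c : ℤ, ∃ v0 w, v = c • v0 ∧ β v0 w = 1)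
    (t : Fin 12 → N) (k : ℕ)
    (orth : ∀ i i', i.val < k → β (t i) (t i') = if i = i' then epsv i else 0)
    (p q : Fin 12) (hp : k ≤ p.val) (hq : k ≤ q.val)
    (hpp : β (t p) (t p) % 2 = 1) (hqq : β (t q) (t q) % 2 = 1) (hpq : β (t p) (t q) % 2 = 0)
    (v : N) (hv0 : v ≠ 0) (hv : β v v = 0) (hvt : ∀ i, i.val < k → β v (t i) = 0) :
    ∃ v0 w, β v0 v0 = 0 ∧ (∀ i, i.val < k → β v0 (t i) = 0) ∧ β v0 (t p) % 2 = 1 ∧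
      β v0 w = 1 ∧ (∀ i, i.val < k → β w (t i) = 0) := by
  -- normalization of an isotropic vector
  have norm : ∀ v, v ≠ 0 → β v v = 0 → (∀ i, i.val < k → β v (t i) = 0) →
      ∃ c : ℤ, c ≠ 0 ∧ ∃ v0 w, v = c • v0 ∧ β v0 v0 = 0 ∧ (∀ i, i.val < k → β v0 (t i) = 0) ∧
      β v0 w = 1 ∧ (∀ i, i.val < k → β w (t i) = 0) := by
    intro v hv0 hv hvt
    obtain ⟨c, v0, w, hc, hw⟩ := P v hv0
    have hc0 : c ≠ 0 := by rintro rfl; simp at hc; exact hv0 hc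
    have h1 : β v0 v0 = 0 := by
      rw [hc] at hv
      simpa [hc0] using hv
    have h2 : ∀ i, i.val < k → β v0 (t i) = 0 := by
      intro i hi
      have := hvt i hi
      rw [hc] at this
      simpa [hc0] using this
    obtain ⟨w', hw1, hw2⟩ := proj_ex β t k orth w
    exact ⟨c, hc0, v0, w', hc, h1, h2, by rw [hw2 v0 h2, hw], hw1⟩
  have tperp : ∀ r : Fin 12, k ≤ r.val → ∀ i, i.val < k → β (t r) (t i) = 0 := by
    intro r hr i hi
    rw [hs, orth i r hi, if_neg]
    rintro rfl; omega
  -- enough: isotropic with odd pairing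
  suffices h : ∃ v, β v v = 0 ∧ (∀ i, i.val < k → β v (t i) = 0) ∧ β v (t p) % 2 = 1 by
    obtain ⟨v, h1, h2, h3⟩ := h
    have hv0 : v ≠ 0 := by rintro rfl; simp at h3
    obtain ⟨c, hc0, v0, w, hc, h4, h5, h6, h7⟩ := norm v hv0 h1 h2
    refine ⟨v0, w, h4, h5, ?_, h6, h7⟩
    rw [hc, map_smul, LinearMap.smul_apply, smul_eq_mul, Int.mul_emod] at h3
    rcases Int.emod_two_eq_zero_or_one (β v0 (t p)) with h | h
    · rw [h] at h3; simp at h3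
    · exact h
  obtain ⟨c, hc0, v0, w, hc, h4, h5, h6, h7⟩ := norm v hv0 hv hvt
  by_cases hvp : β v0 (t p) % 2 = 1
  · exact ⟨v0, h4, h5, hvp⟩
  suffices h : ∃ y, (∀ i, i.val < k → β y (t i) = 0) ∧ β v0 y % 2 = 1 ∧ β y (t p) % 2 = 1 ∧
      β y y % 2 = 0 by
    obtain ⟨y, hy1, hy2, hy3, hy4⟩ := h
    refine ⟨(β v0 y) • y - (β y y / 2) • v0, ?_, ?_, ?_⟩
    · simp only [map_sub, LinearMap.sub_apply, map_smul, LinearMap.smul_apply, smul_eq_mul, h4]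
      rw [hs y v0]
      have : β y y = 2 * (β y y / 2) := by omega
      linear_combination (β v0 y)^2 * this
    · intro i hi
      simp [hy1 i hi, h5 i hi]
    · simp only [map_sub, LinearMap.sub_apply, map_smul, LinearMap.smul_apply, smul_eq_mul]
      have e1 : β v0 y = 2 * (β v0 y / 2) + 1 := by omega
      have e2 : β y (t p) = 2 * (β y (t p) / 2) + 1 := by omega
      have e3 : β v0 (t p) = 2 * (β v0 (t p) / 2) := by omega
      generalize β v0 y / 2 = A at *
      generalize β y (t p) / 2 = C at *
      generalize β v0 (t p) / 2 = D at *
      rw [e1, e2, e3]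
      have : (2 * A + 1) * (2 * C + 1) - β y y / 2 * (2 * D)
         = 2 * (2 * A * C + A + C - β y y / 2 * D) + 1 := by ring
      rw [this]; omega
  have hvp0 : β v0 (t p) % 2 = 0 := by omega
  by_cases hvq : β v0 (t q) % 2 = 1
  · refine ⟨t p + t q, ?_, ?_, ?_, ?_⟩
    · intro i hi
      simp [tperp p hp i hi, tperp q hq i hi]
    · rw [map_add]; omega
    · rw [map_add, LinearMap.add_apply, hs (t q)]; omega
    · simp only [map_add, LinearMap.add_apply]; rw [hs (t q) (t p)]; omega
  have hvq0 : β v0 (t q) % 2 = 0 := by omega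
  -- y = w + α t p + γ t q
  have key : ∀ α γ : ℤ, ∀ i, i.val < k → β (w + α • t p + γ • t q) (t i) = 0 := by
    intro α γ i hi
    simp [tperp p hp i hi, tperp q hq i hi, h7 i hi]
  have : ∃ α γ : ℤ, (α = 0 ∨ α = 1) ∧ (γ = 0 ∨ γ = 1) ∧ (β w (t p) + α) % 2 = 1 ∧
      (β w w + α + γ) % 2 = 0 := by
    refine ⟨(β w (t p) + 1) % 2, (β w w + (β w (t p) + 1) % 2) % 2, ?_, ?_, ?_, ?_⟩ <;> omega
  obtain ⟨α, γ, hα, hγ, e1, e2⟩ := this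
  refine ⟨w + α • t p + γ • t q, key α γ, ?_, ?_, ?_⟩
  · simp only [map_add, map_smul, smul_eq_mul, h6]
    rcases hα with rfl | rfl <;> rcases hγ with rfl | rfl <;> simp <;> omega
  · simp only [map_add, map_smul, LinearMap.add_apply, LinearMap.smul_apply, smul_eq_mul]
    rw [hs (t q) (t p)]
    rcases hα with rfl | rfl <;> rcases hγ with rfl | rfl <;> omega
  · simp only [map_add, map_smul, LinearMap.add_apply, LinearMap.smul_apply, smul_eq_mul]
    rw [hs (t q) (t p), hs (t q) w, hs (t p) w]
    rcases hα with rfl | rfl <;> rcases hγ with rfl | rfl <;> omega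

lemma peel_step {N V A : Type*} [AddCommGroup N] [AddCommGroup V] [Module ℚ V] [DecidableEq A]
    (β : N →ₗ[ℤ] N →ₗ[ℤ] ℤ) (B : V →ₗ[ℚ] V →ₗ[ℚ] ℚ) (j : N →+ V) (a : A → V) (s : Fin 12 → N)
    (hs : ∀ x y, β x y = β y x) (hB : ∀ x y, B x y = B y x)
    (P : ∀ v, v ≠ 0 → ∃ c : ℤ, ∃ v0 w, v = c • v0 ∧ β v0 w = 1)
    (hj : ∀ x y, B (j x) (j y) = β x y)
    (hNa : ∀ x i, B (j x) (a i) = 0)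
    (hclear : ∀ x, (∀ i, B x (a i) = 0) → ∃ m : ℚ, m ≠ 0 ∧ ∃ y, j y = m • x)
    (hd : ∀ i, (β (s i) (s i) - epsv i) % 4 = 0)
    (ho : ∀ i i', i ≠ i' → β (s i) (s i') % 2 = 0)
    (k : ℕ) (hk : k ≤ 10) (t : Fin 12 → N) (e : A ⊕ Fin 12 → V)
    (S : PState β B j a s k t e) : ∃ t' e', PState β B j a s (k+1) t' e' := by
  obtain ⟨cong, orth, frame, ea, et⟩ := S
  have hsg : ∀ i : A ⊕ Fin 12, Sum.elim (fun _ => (-1:ℚ)) (fun i => (epsv i : ℚ)) i ≠ 0 := by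
    rintro (i | i)
    · simp
    · simp only [Sum.elim_inr]
      have := epsv_odd i
      intro h
      have : epsv i = 0 := by exact_mod_cast h
      omega
  have hd' : ∀ i, (β (t i) (t i) - epsv i) % 4 = 0 := by
    intro i
    obtain ⟨u, hu⟩ := cong i
    have := hd i
    rw [hu]
    simp only [map_add, map_smul, LinearMap.add_apply, LinearMap.smul_apply, smul_eq_mul]
    rw [hs u (s i)]
    omega
  have ho' : ∀ i i', i ≠ i' → β (t i) (t i') % 2 = 0 := by
    intro i i' hi
    obtain ⟨u, hu⟩ := cong i
    obtain ⟨u', hu'⟩ := cong i'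
    have := ho i i' hi
    rw [hu, hu']
    simp only [map_add, map_smul, LinearMap.add_apply, LinearMap.smul_apply, smul_eq_mul]
    omega
  have hodd : ∀ i, β (t i) (t i) % 2 = 1 := by
    intro i
    have := hd' i
    have := epsv_odd i
    omega
  set p : Fin 12 := ⟨k, by omega⟩ with hp
  have hpv : p.val = k := rfl
  -- isotropic vector
  have hiso : ∃ v : N, v ≠ 0 ∧ β v v = 0 ∧ ∀ i, i.val < k → β v (t i) = 0 := by
    set x := e (Sum.inr 10) + e (Sum.inr 11) with hx
    have hxa : ∀ i, B x (a i) = 0 := by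
      intro i
      rw [← ea, hx, map_add, LinearMap.add_apply, frame.gram, frame.gram]
      simp
    have hxx : B x x = 0 := by
      rw [hx]
      simp only [map_add, LinearMap.add_apply, frame.gram]
      simp [epsv]
    have hx10 : B x (e (Sum.inr 10)) = -1 := by
      rw [hx]
      simp only [map_add, LinearMap.add_apply, frame.gram]
      simp [epsv]
    obtain ⟨m, hm, y, hy⟩ := hclear x hxa
    refine ⟨y, ?_, ?_, ?_⟩
    · rintro rfl
      rw [map_zero] at hy
      have : x = 0 := by
        rcases smul_eq_zero.mp hy.symm with h | h
        · exact absurd h hm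
        · exact h
      rw [this] at hx10
      simp at hx10
    · have := hj y y
      rw [hy] at this
      simp [hxx] at this
      exact_mod_cast this.symm
    · intro i hi
      have := hj y (t i)
      rw [hy, ← et i hi, hx] at this
      simp only [map_smul, LinearMap.smul_apply, map_add, LinearMap.add_apply, frame.gram] at this
      have h10 : ¬ (10 : Fin 12) = i := by
        rintro rfl; simp at hi; omega
      have h11 : ¬ (11 : Fin 12) = i := by
        rintro rfl; simp at hi; omega
      simp [h10, h11] at this
      exact_mod_cast this.symm
  obtain ⟨v, hv0, hvv, hvt⟩ := hiso
  have hp11 : p ≠ 11 := by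
    intro h
    have := congrArg Fin.val h
    simp [hpv] at this
    omega
  obtain ⟨v0, w, h1, h2, h3, h4, h5⟩ := good_iso β hs P t k orth p 11 (le_of_eq hpv.symm)
    (by simp; omega) (hodd p) (hodd 11) (ho' p 11 hp11) v hv0 hvv hvt
  have tperp : ∀ r : Fin 12, k ≤ r.val → ∀ i, i.val < k → β (t r) (t i) = 0 := by
    intro r hr i hi
    rw [hs, orth i r hi, if_neg]
    rintro rfl; omega
  -- construct new vector
  have hT : ∃ u, β (t p + (2:ℤ) • u) (t p + (2:ℤ) • u) = epsv p ∧ ∀ i, i.val < k → β u (t i) = 0 := by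
    set α := (1 - β v0 (t p)) / 2 with hα
    set y := t p + (2 : ℤ) • (α • w) with hy
    have hyv : β y v0 = 1 := by
      rw [hy]
      simp only [map_add, map_smul, LinearMap.add_apply, LinearMap.smul_apply, smul_eq_mul]
      rw [hs w v0, h4, hs (t p) v0]
      omega
    have hyy : (β y y - epsv p) % 4 = 0 := by
      have := hd' p
      rw [hy]
      generalize α • w = z
      simp only [map_add, map_smul, LinearMap.add_apply, LinearMap.smul_apply, smul_eq_mul]
      rw [hs z (t p)]
      omega
    refine ⟨α • w + ((epsv p - β y y) / 4) • v0, ?_, ?_⟩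
    · have : t p + (2:ℤ) • (α • w + ((epsv p - β y y) / 4) • v0)
         = y + (2 * ((epsv p - β y y) / 4)) • v0 := by rw [hy]; module
      rw [this]
      generalize hb : (epsv p - β y y) / 4 = b
      simp only [map_add, map_smul, LinearMap.add_apply, LinearMap.smul_apply, smul_eq_mul]
      rw [hs v0 y, hyv, h1]
      omega
    · intro i hi
      simp [h2 i hi, h5 i hi]
  obtain ⟨u, hu1, hu2⟩ := hT
  set T := t p + (2:ℤ) • u with hTdef
  have hTt : ∀ i, i.val < k → β T (t i) = 0 := by
    intro i hi
    rw [hTdef]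
    simp [tperp p hpv.ge i hi, hu2 i hi]
  have hTe : ∀ r, r ≠ p → β (t r) T % 2 = 0 := by
    intro r hr
    have := ho' r p hr
    rw [hTdef, map_add, map_smul, smul_eq_mul]; omega
  obtain ⟨e', f1, f2, f3⟩ := witt hB frame hsg
    (fun i => Sum.elim (fun _ => True) (fun i : Fin 12 => i.val < k) i) (Sum.inr p) (by simp [hpv])
    (j T) (by rw [hj, hu1]; simp) (by
      rintro (i | i) hi
      · rw [ea]; exact hNa _ _
      · simp only [Sum.elim_inr] at hi
        rw [et i hi, hj, hTt i hi]; simp)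
  refine ⟨fun i => if i.val < k then t i else if i = p then T else
      t i - (epsv p * β (t i) T) • T, e', ?_, ?_, f1, ?_, ?_⟩
  · intro i
    split_ifs with c1 c2
    · exact cong i
    · subst c2
      obtain ⟨u', hu'⟩ := cong p
      exact ⟨u' + u, by rw [hTdef, hu']; module⟩
    · obtain ⟨u', hu'⟩ := cong i
      refine ⟨u' - (epsv p * (β (t i) T / 2)) • T, ?_⟩
      have : β (t i) T = 2 * (β (t i) T / 2) := by have := hTe i c2; omega
      rw [smul_sub, ← add_sub_assoc, ← hu', smul_smul]
      congr 2
      linear_combination epsv p * this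
  · intro i i' hi
    by_cases c1 : i.val < k
    · rw [if_pos c1]
      split_ifs with d1 d2 d3 d4 d5
      · rw [orth i i' c1, if_pos d2]
      · rw [orth i i' c1, if_neg d2]
      · subst d4; omega
      · rw [hs, hTt i c1]
      · subst d5; omega
      · rw [map_sub, map_smul, hs (t i) T, hTt i c1, smul_zero, orth i i' c1, if_neg d5, sub_zero]
    · have hip : i = p := by ext; rw [hpv]; omega
      subst hip
      rw [if_neg c1, if_pos rfl]
      split_ifs with d1 d2 d3 d4 d5
      · subst d2; omega
      · exact hTt i' d1
      · exact hu1
      · exact absurd d3.symm d4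
      · exact absurd d5.symm d3
      · rw [map_sub, map_smul, hu1, hs T, smul_eq_mul]
        linear_combination - β (t i') T * epsv_sq p
  · intro i; rw [f2 (Sum.inl i) (by simp), ea]
  · intro i hi
    by_cases c1 : i.val < k
    · rw [if_pos c1, f2 (Sum.inr i) (by simpa using c1), et i c1]
    · have hip : i = p := by ext; rw [hpv]; omega
      subst hip
      rw [if_neg c1, if_pos rfl, f3]

lemma peel {N V A : Type*} [AddCommGroup N] [AddCommGroup V] [Module ℚ V] [DecidableEq A]
    (β : N →ₗ[ℤ] N →ₗ[ℤ] ℤ) (B : V →ₗ[ℚ] V →ₗ[ℚ] ℚ) (j : N →+ V) (a : A → V) (s : Fin 12 → N)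
    (hs : ∀ x y, β x y = β y x) (hB : ∀ x y, B x y = B y x)
    (P : ∀ v, v ≠ 0 → ∃ c : ℤ, ∃ v0 w, v = c • v0 ∧ β v0 w = 1)
    (hj : ∀ x y, B (j x) (j y) = β x y)
    (hNa : ∀ x i, B (j x) (a i) = 0)
    (hclear : ∀ x, (∀ i, B x (a i) = 0) → ∃ m : ℚ, m ≠ 0 ∧ ∃ y, j y = m • x)
    (hd : ∀ i, (β (s i) (s i) - epsv i) % 4 = 0)
    (ho : ∀ i i', i ≠ i' → β (s i) (s i') % 2 = 0)
    (hjinj : ∀ x, j x = 0 → x = 0)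
    (e : A ⊕ Fin 12 → V) (he : IsFrame B e (Sum.elim (fun _ => -1) (fun i => (epsv i : ℚ))))
    (hea : ∀ i, e (Sum.inl i) = a i) :
    ∃ t : Fin 12 → N, (∀ i, ∃ u, t i = s i + (2 : ℤ) • u) ∧
      (∀ i i', β (t i) (t i') = if i = i' then epsv i else 0) ∧
      (∀ x, (∀ i, β x (t i) = 0) → x = 0) := by
  have main : ∀ k, k ≤ 11 → ∃ t' e', PState β B j a s k t' e' := by
    intro k
    induction k with
    | zero =>
      intro _
      exact ⟨s, e, fun i => ⟨0, by simp⟩, fun i i' h => absurd h (by omega), he, hea,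
        fun i h => absurd h (by omega)⟩
    | succ k ih =>
      intro hk
      obtain ⟨t, e, S⟩ := ih (by omega)
      exact peel_step β B j a s hs hB P hj hNa hclear hd ho k (by omega) t e S
  obtain ⟨t, e, cong, orth, frame, ea, et⟩ := main 11 le_rfl
  have lt11 : ∀ i : Fin 12, i ≠ 11 → i.val < 11 := by
    intro i hi
    have : i.val ≠ 11 := fun h => hi (Fin.ext h)
    omega
  have t11 : ∀ i : Fin 12, i.val < 11 → β (t 11) (t i) = 0 := by
    intro i hi
    rw [hs, orth i 11 hi, if_neg]
    rintro rfl; simp at hi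
  have hd' : (β (t 11) (t 11) - 1) % 4 = 0 := by
    obtain ⟨u, hu⟩ := cong 11
    have := hd 11
    have h1 : epsv 11 = 1 := rfl
    rw [h1] at this
    rw [hu]
    simp only [map_add, map_smul, LinearMap.add_apply, LinearMap.smul_apply, smul_eq_mul]
    rw [hs u (s 11)]
    omega
  have hne : t 11 ≠ 0 := by
    intro h; rw [h] at hd'; simp at hd'
  obtain ⟨c, v0, w0, hc, hw0⟩ := P _ hne
  have hc0 : c ≠ 0 := by rintro rfl; simp at hc; exact hne hc
  have h2 : ∀ i : Fin 12, i.val < 11 → β v0 (t i) = 0 := by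
    intro i hi
    have := t11 i hi
    rw [hc] at this
    simpa [hc0] using this
  obtain ⟨w, hw1, hw2⟩ := proj_ex β t 11 orth w0
  have hw : β v0 w = 1 := by rw [hw2 v0 h2, hw0]
  -- one dimensionality
  have one : ∀ x : N, (∀ i : Fin 12, i.val < 11 → β x (t i) = 0) →
      j x = (B (j x) (e (Sum.inr 11))) • e (Sum.inr 11) := by
    intro x hx
    rw [← sub_eq_zero]
    apply frame.span
    rintro (i | i)
    · rw [map_sub, LinearMap.sub_apply, map_smul, LinearMap.smul_apply, frame.gram, ea, hNa]
      simp
    · by_cases hi : i = 11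
      · subst hi
        rw [map_sub, LinearMap.sub_apply, map_smul, LinearMap.smul_apply, frame.gram]
        simp [epsv]
      · rw [map_sub, LinearMap.sub_apply, map_smul, LinearMap.smul_apply, frame.gram,
          et i (lt11 i hi), hj, hx i (lt11 i hi)]
        simp [Ne.symm hi]
  have prod : β v0 v0 * β w w = 1 := by
    have e1 := hj v0 v0
    have e2 := hj w w
    have e3 := hj v0 w
    rw [hw] at e3
    rw [one v0 h2] at e1 e3
    rw [one w hw1] at e2 e3
    simp only [map_smul, LinearMap.smul_apply, smul_eq_mul] at e1 e2 e3
    have : ((β v0 v0 : ℤ) : ℚ) * (β w w : ℤ) = 1 := by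
      rw [← e1, ← e2]
      push_cast at e3
      generalize (B (j v0)) (e (Sum.inr 11)) = l1 at *
      generalize (B (j w)) (e (Sum.inr 11)) = l2 at *
      generalize (B (e (Sum.inr 11))) (e (Sum.inr 11)) = l3 at *
      have : l1 * (l1 * l3) * (l2 * (l2 * l3)) = (l1 * (l2 * l3))^2 := by ring
      rw [this, show l1 * (l2 * l3) = 1 by linarith]; norm_num
    exact_mod_cast this
  have hcc : β (t 11) (t 11) = c * (c * β v0 v0) := by
    rw [hc]; simp
  have hcodd : c % 2 = 1 := by
    rcases Int.emod_two_eq_zero_or_one c with h | h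
    · exfalso
      have h' : c = 2 * (c / 2) := by omega
      rw [hcc, h'] at hd'
      have : 2 * (c / 2) * (2 * (c / 2) * (β v0) v0) = 4 * (c/2 * (c/2) * β v0 v0) := by ring
      rw [this] at hd'
      omega
    · exact h
  have hv0 : β v0 v0 = 1 := by
    rcases Int.eq_one_or_neg_one_of_mul_eq_one prod with h | h
    · exact h
    · exfalso
      have h' : c = 2 * (c / 2) + 1 := by omega
      rw [hcc, h', h] at hd'
      have : (2 * (c / 2) + 1) * ((2 * (c / 2) + 1) * -1) = - 4 * (c/2 * (c/2) + c/2) - 1 := by ring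
      rw [this] at hd'
      omega
  have hv0c : ∃ u, v0 = s 11 + (2:ℤ) • u := by
    obtain ⟨u, hu⟩ := cong 11
    obtain ⟨q, hq⟩ : ∃ q, c = 2 * q + 1 := ⟨c / 2, by omega⟩
    refine ⟨u - q • v0, ?_⟩
    have : s 11 = c • v0 - (2:ℤ) • u := by rw [← hc, hu]; simp
    rw [this, hq]
    module
  have h11 : epsv 11 = 1 := rfl
  have orth' : ∀ i i', β (if i = 11 then v0 else t i) (if i' = 11 then v0 else t i') = if i = i' then epsv i else 0 := by
    intro i i'
    split_ifs with d1 d2 d3 d4 d5 d6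
    · rw [d1, hv0, h11]
    · exact absurd (d1.trans d2.symm) d3
    · exact absurd (d4.symm.trans d1) d2
    · exact h2 i' (lt11 i' d2)
    · exact absurd (d6.trans d5) d1
    · rw [hs]; exact h2 i (lt11 i d1)
    · rw [orth i i' (lt11 i d1), if_pos (by assumption)]
    · rw [orth i i' (lt11 i d1), if_neg (by assumption)]
  refine ⟨fun i => if i = 11 then v0 else t i, ?_, orth', ?_⟩
  · intro i
    by_cases hi : i = 11
    · subst hi; simpa using hv0c
    · simpa [hi] using cong i
  · intro x hx
    have hx1 : ∀ i : Fin 12, i.val < 11 → β x (t i) = 0 := by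
      intro i hi
      have := hx i
      have hi' : i ≠ 11 := by rintro rfl; simp at hi
      simpa [hi'] using this
    have hx2 : β x v0 = 0 := by simpa using hx 11
    apply hjinj
    rw [one x hx1]
    have e3 := hj x v0
    have e1 := hj v0 v0
    rw [hv0, one v0 h2] at e1
    rw [hx2, one v0 h2] at e3
    simp only [map_smul, LinearMap.smul_apply, smul_eq_mul] at e1 e3
    have : (B (j v0)) (e (Sum.inr 11)) ≠ 0 := by
      intro h; rw [h] at e1; simp at e1
    have : B (j x) (e (Sum.inr 11)) = 0 := by
      simpa [this] using e3
    rw [this]; simp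

def E8I : Matrix (Fin 8) (Fin 8) ℤ :=
  !![4,5,7,10,8,6,4,2;
     5,8,10,15,12,9,6,3;
     7,10,14,20,16,12,8,4;
     10,15,20,30,24,18,12,6;
     8,12,16,24,20,15,10,5;
     6,9,12,18,15,12,8,4;
     4,6,8,12,10,8,6,3;
     2,3,4,6,5,4,3,2]

def d2M : Matrix (Fin 12) (Fin 12) ℤ :=
  !![1,3,1,-1,-1,1,-1,1,1,-1,-1,1;
     1,-1,1,-1,-1,1,-1,-1,-1,3,-1,1;
     -1,1,1,-1,1,1,1,3,1,-1,-1,-1;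
     1,-1,-1,-1,-1,-1,-1,-1,1,1,-1,1;
     1,-1,1,1,-1,1,-1,1,-1,1,-1,-1;
     1,-1,-1,-1,-1,1,1,1,-1,-1,1,1;
     1,-1,1,1,1,1,-1,1,-1,1,-1,1;
     1,1,-1,-1,-1,1,-1,1,-1,-1,1,1;
     1,-1,-1,1,-1,-1,-1,-1,1,-1,-1,1;
     1,1,1,1,1,-1,1,-1,1,1,-1,-1;
     1,-1,1,-1,1,1,-1,-1,1,-1,1,-1;
     1,-1,3,1,1,1,-1,-1,1,1,-1,-1]

def GdM : Matrix (Fin 12) (Fin 12) ℤ :=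
  !![5,0,2,0,0,0,0,2,0,0,0,0;
     0,5,-2,2,2,0,2,0,0,0,0,2;
     2,-2,5,-2,0,0,0,0,-2,0,0,0;
     0,2,-2,3,0,0,0,0,2,0,0,0;
     0,2,0,0,3,0,2,0,0,0,0,2;
     0,0,0,0,0,3,0,2,0,-2,0,-2;
     0,2,0,0,2,0,3,0,0,0,0,2;
     2,0,0,0,0,2,0,3,0,-2,0,-2;
     0,0,-2,2,0,0,0,0,3,0,0,0;
     0,0,0,0,0,-2,0,-2,0,3,0,2;
     0,0,0,0,0,0,0,0,0,0,3,2;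
     0,2,0,0,2,-2,2,-2,0,2,2,5]

def GdI : Matrix (Fin 12) (Fin 12) ℤ :=
  !![77,-36,-58,20,48,20,48,-134,-52,-20,56,-84;
     -36,25,30,-18,-22,-12,-22,60,32,12,-20,30;
     -58,30,45,-18,-36,-16,-36,100,42,16,-40,60;
     20,-18,-18,15,12,8,12,-32,-22,-8,8,-12;
     48,-22,-36,12,31,12,30,-84,-32,-12,36,-54;
     20,-12,-16,8,12,7,12,-34,-16,-6,12,-18;
     48,-22,-36,12,30,12,31,-84,-32,-12,36,-54;
     -134,60,100,-32,-84,-34,-84,235,88,34,-100,150;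
     -52,32,42,-22,-32,-16,-32,88,43,16,-32,48;
     -20,12,16,-8,-12,-6,-12,34,16,7,-12,18;
     56,-20,-40,8,36,12,36,-100,-32,-12,47,-70;
     -84,30,60,-12,-54,-18,-54,150,48,18,-70,105]

def FM : Matrix (Fin 24) (Fin 24) ℤ :=
  !![0,0,0,0,0,0,0,0,1,1,2,2,1,0,0,0,0,0,0,0,0,0,0,0;
     0,0,0,0,0,0,0,0,1,1,2,2,2,2,1,0,0,0,0,0,0,0,0,0;
     0,0,0,0,0,0,0,0,1,2,2,4,3,2,1,0,0,0,0,0,0,0,0,0;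
     0,0,0,0,0,0,0,0,2,3,4,6,5,4,3,2,0,0,0,0,0,0,0,0;
     0,0,0,0,0,0,0,0,0,0,0,0,0,0,0,0,0,0,0,0,0,0,1,0;
     0,0,0,0,0,0,0,0,0,0,0,0,0,0,0,0,0,1,0,0,0,0,0,0;
     0,0,0,0,0,0,0,0,0,0,0,0,0,0,0,0,1,0,0,0,0,0,0,0;
     0,0,0,0,0,0,0,0,0,0,0,0,0,0,0,0,0,0,0,0,1,0,0,0;
     0,0,0,0,0,0,0,0,0,0,0,0,0,0,0,0,1,1,2,2,1,0,0,0;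
     0,0,0,0,0,0,0,0,0,0,0,0,0,0,0,0,1,1,2,2,2,2,1,0;
     0,0,0,0,0,0,0,0,0,0,0,0,0,0,0,0,1,2,2,4,3,2,1,0;
     0,0,0,0,0,0,0,0,0,0,0,0,0,0,0,0,2,3,4,6,5,4,3,2;
     1,1,0,0,0,0,0,0,0,0,0,0,0,0,0,0,0,0,0,0,0,0,0,0;
     0,0,1,1,0,0,0,0,0,0,0,0,0,0,0,0,0,0,0,0,0,0,0,0;
     0,0,0,0,1,1,0,0,0,0,0,0,0,0,0,0,0,0,0,0,0,0,0,0;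
     1,-1,0,0,0,0,0,0,0,0,0,0,0,0,0,0,0,0,0,0,0,0,0,0;
     0,0,1,-1,0,0,0,0,0,0,0,0,0,0,0,0,0,0,0,0,0,0,0,0;
     0,0,0,0,1,-1,0,0,0,0,0,0,0,0,0,0,0,0,0,0,0,0,0,0;
     0,0,0,0,0,0,1,-1,0,0,0,0,0,0,0,0,0,0,0,0,0,0,0,0;
     0,0,0,0,0,0,0,0,0,0,0,0,0,0,1,0,0,0,0,0,0,0,0,0;
     0,0,0,0,0,0,0,0,0,1,0,0,0,0,0,0,0,0,0,0,0,0,0,0;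
     0,0,0,0,0,0,0,0,1,0,0,0,0,0,0,0,0,0,0,0,0,0,0,0;
     0,0,0,0,0,0,0,0,0,0,0,0,1,0,0,0,0,0,0,0,0,0,0,0;
     0,0,0,0,0,0,1,1,0,0,0,0,0,0,0,0,0,0,0,0,0,0,0,0]

def EM : Matrix (Fin 12) (Fin 24) ℤ :=
  !![0,0,0,0,0,0,-6,-3,-4,-6,-8,-15,-11,-8,-8,-3,2,2,2,6,4,3,2,0;
     2,0,2,0,0,0,-4,-2,0,1,0,-1,0,1,-1,0,-1,-1,-1,1,1,1,-1,-1;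
     -2,0,0,0,0,0,-6,-2,-4,-6,-8,-14,-11,-8,-7,-3,-2,-3,-6,-5,-5,-5,-3,-2;
     3,0,0,0,0,0,4,1,4,6,8,13,11,8,6,3,2,2,4,4,4,3,2,2;
     0,0,3,0,0,0,-8,-4,-6,-7,-12,-19,-14,-9,-9,-4,-3,-3,-5,-3,-3,-3,-3,-3;
     0,0,0,0,3,0,12,6,10,14,20,34,27,18,17,7,4,5,8,7,5,5,5,4;
     0,0,2,0,0,0,-6,-3,-4,-4,-8,-13,-10,-7,-7,-3,-3,-3,-5,-4,-4,-3,-3,-2;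
     0,0,0,0,2,0,8,4,6,8,12,20,16,10,10,4,5,6,10,11,8,7,6,4;
     2,0,0,0,0,0,3,0,1,2,2,4,4,3,2,1,1,1,2,1,1,1,1,1;
     0,0,0,0,-2,0,-12,-6,-9,-12,-18,-30,-24,-16,-16,-6,-4,-4,-8,-6,-4,-4,-4,-4;
     0,0,0,0,0,0,-7,-5,-6,-9,-12,-21,-17,-11,-11,-5,-3,-2,-5,-2,-2,-2,-2,-2;
     0,0,2,0,-2,0,-20,-11,-15,-20,-30,-51,-40,-26,-26,-11,-8,-8,-15,-11,-9,-8,-8,-7]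

def RM : Matrix (Fin 24) (Fin 12) ℤ :=
  !![-1,0,0,-1,0,0,0,0,0,0,0,0;
     -1,0,0,-1,0,0,0,0,0,0,0,0;
     0,-1,0,0,-1,0,0,0,0,0,0,0;
     0,-1,0,0,-1,0,0,0,0,0,0,0;
     0,0,-1,0,0,-1,0,0,0,0,0,0;
     0,0,-1,0,0,-1,0,0,0,0,0,0;
     5,2,-6,-2,6,-3,-1,-10,0,0,7,-14;
     9,4,-12,-5,12,-6,-2,-20,0,0,14,-28;
     0,0,0,0,0,0,0,0,0,1,0,0;
     3,2,-5,-1,5,-3,-1,-6,0,0,4,-9;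
     -1,2,-1,-2,0,-3,-3,1,2,0,1,-3;
     -3,-3,5,2,-5,4,3,6,-1,0,-5,11;
     -1,0,2,1,-1,1,-1,3,0,0,-2,3;
     7,3,-8,-3,8,-4,-1,-14,1,0,10,-19;
     -7,-4,8,4,-8,5,2,14,-2,-1,-11,22;
     2,2,-2,-2,2,-2,0,-4,1,1,4,-7;
     3,-2,-2,1,1,1,2,-5,-2,-1,1,-2;
     -3,-2,3,1,-4,2,0,6,0,0,-4,8;
     -8,0,8,1,-8,1,-1,16,3,1,-9,17;
     5,3,-5,-3,7,-2,0,-11,0,0,8,-15;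
     0,-1,-1,2,0,-1,-1,1,-1,0,-1,1;
     4,-1,-3,0,2,1,2,-7,-2,-1,3,-5;
     -4,1,3,-1,-2,0,-2,6,2,1,-3,5;
     1,-3,1,3,-2,2,3,0,-2,-1,-1,4]

def PM : Matrix (Fin 12) (Fin 12) ℤ :=
  !![1,0,0,1,0,0,0,0,0,0,0,0;
     1,0,0,0,1,0,0,0,0,0,0,0;
     0,1,0,0,0,1,0,0,0,0,0,0;
     0,1,0,0,0,0,1,0,0,0,0,0;
     0,0,1,0,0,0,0,1,0,0,0,0;
     0,0,1,0,0,0,0,0,1,0,0,0;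
     0,0,0,0,0,0,0,0,0,1,0,1;
     0,0,0,0,0,0,0,0,0,0,1,1;
     1,0,0,1,1,0,0,0,0,0,0,0;
     0,1,0,0,0,1,1,0,0,0,0,0;
     0,0,1,0,0,0,0,1,1,0,0,0;
     0,0,0,0,0,0,0,0,0,1,1,1]

def PI : Matrix (Fin 12) (Fin 12) ℤ :=
  !![1,1,0,0,0,0,0,0,-1,0,0,0;
     0,0,1,1,0,0,0,0,0,-1,0,0;
     0,0,0,0,1,1,0,0,0,0,-1,0;
     0,-1,0,0,0,0,0,0,1,0,0,0;
     -1,0,0,0,0,0,0,0,1,0,0,0;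
     0,0,0,-1,0,0,0,0,0,1,0,0;
     0,0,-1,0,0,0,0,0,0,1,0,0;
     0,0,0,0,0,-1,0,0,0,0,1,0;
     0,0,0,0,-1,0,0,0,0,0,1,0;
     0,0,0,0,0,0,0,-1,0,0,0,1;
     0,0,0,0,0,0,-1,0,0,0,0,1;
     0,0,0,0,0,0,1,1,0,0,0,-1]

/-- flat index -/
def ixM : MukaiIx → Fin 24
  | .inl (i, a) => ⟨2 * i.val + a.val, by omega⟩
  | .inr (i, a) => ⟨8 + 8 * i.val + a.val, by omega⟩

/-- inverse Gram -/
def GLI : Matrix MukaiIx MukaiIx ℤ :=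
  Matrix.of fun p q =>
    match p, q with
    | .inl (i, a), .inl (j, b) => if i = j ∧ a ≠ b then 1 else 0
    | .inr (i, a), .inr (j, b) => if i = j then -(E8I a b) else 0
    | _, _ => 0

/-- initial frame -/
def F0 : Matrix (Fin 12 ⊕ Fin 12) MukaiIx ℤ := Matrix.of fun p q => FM (finSumFinEquiv p) (ixM q)

/-- explicit embedding -/
def E0 : Matrix (Fin 12) MukaiIx ℤ := Matrix.of fun p q => EM p (ixM q)

/-- explicit retraction -/
def R0 : Matrix MukaiIx (Fin 12) ℤ := Matrix.of fun p q => RM (ixM p) q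

/-- flat index -/
def ixT : T0Ix → Fin 12
  | .inl (i, a) => ⟨2 * i.val + a.val, by omega⟩
  | .inr i => ⟨8 + i.val, by omega⟩

/-- base change -/
def P0 : Matrix T0Ix (Fin 12) ℤ := Matrix.of fun p q => PM (ixT p) q

/-- base change -/
def Q0 : Matrix (Fin 12) T0Ix ℤ := Matrix.of fun p q => PI p (ixT q)

/-- signs -/
def sgz : Fin 12 ⊕ Fin 12 → ℤ := Sum.elim (fun _ => -1) epsv

set_option maxRecDepth 100000

lemma GLM_GLI : GLM * GLI = 1 := by decide +kernel
lemma GLM_symm : GLMᵀ = GLM := by decide +kernel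
lemma Gd_GdI : GdM * GdI = 1 := by decide +kernel
lemma GdI_Gd : GdI * GdM = 1 := by decide +kernel
lemma Gd_symm : GdMᵀ = GdM := by decide +kernel
lemma d2_Gd : ∀ i j, ∑ k, d2M i k * d2M j k = 4 * GdM i j := by decide +kernel
lemma d2_span : d2Mᵀ * GdI * d2M = Matrix.of (fun i j => if i = j then 4 else 0) := by decide +kernel
lemma d2_odd : ∀ i k, d2M i k % 2 = 1 := by decide +kernel
lemma d2_sum : ∀ i, (∑ k, d2M i k) % 4 = 0 := by decide +kernel
lemma Gd_diag : ∀ i, (GdM i i - epsv i) % 4 = 0 := by decide +kernel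
lemma Gd_off : ∀ i j, i ≠ j → GdM i j % 2 = 0 := by decide +kernel
lemma E0_gram : E0 * GLM * E0ᵀ = Matrix.of (fun i j => -2 * GdM i j) := by decide +kernel
lemma E0_R0 : E0 * R0 = 1 := by decide +kernel
lemma F0_gram : F0 * GLM * F0ᵀ = Matrix.diagonal (fun i => 2 * sgz i) := by decide +kernel
lemma P0_Q0 : P0 * Q0 = 1 := by decide +kernel
lemma Q0_P0 : Q0 * P0 = 1 := by decide +kernel
lemma P0_gram : P0 * Matrix.diagonal (fun i => 2 * epsv i) * P0ᵀ = GT0 := by decide +kernel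
lemma GLM_diag : ∀ i, GLM i i % 2 = 0 := by decide +kernel

/-- basis vectors of D12plus -/
def dvec (i : Fin 12) : Fin 12 → ℚ := fun k => (d2M i k : ℚ) / 2

lemma dvec_dot (i j : Fin 12) : ∑ k, dvec i k * dvec j k = GdM i j := by
  have h := d2_Gd i j
  have h' : (∑ k, (d2M i k : ℚ) * d2M j k) = 4 * GdM i j := by exact_mod_cast h
  have : ∑ k, dvec i k * dvec j k = (∑ k, (d2M i k : ℚ) * d2M j k) / 4 := by
    rw [Finset.sum_div]
    refine Finset.sum_congr rfl fun k _ => ?_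
    simp only [dvec]; ring
  rw [this, h']; ring

lemma dvec_mem (i : Fin 12) : dvec i ∈ D12plus := by
  have : dvec i = (fun k => (((d2M i k - 1) / 2 : ℤ) : ℚ)) + (fun _ => (1:ℚ)/2) := by
    funext k
    have h := d2_odd i k
    have h2 : d2M i k = 2 * ((d2M i k - 1) / 2) + 1 := by omega
    have h3 : (d2M i k : ℚ) = 2 * (((d2M i k - 1) / 2 : ℤ) : ℚ) + 1 := by exact_mod_cast h2
    simp only [dvec, Pi.add_apply]
    rw [h3]; ring
  rw [this]
  refine Submodule.add_mem _ (Submodule.subset_span (Or.inl ⟨fun k => ⟨_, rfl⟩, ?_⟩))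
    (Submodule.subset_span (Or.inr rfl))
  have hs := d2_sum i
  have h2 : ∑ k, (d2M i k - 1) / 2 = 2 * ((∑ k, (d2M i k - 1) / 2) / 2) := by
    have e : ∑ k, d2M i k = 2 * (∑ k, (d2M i k - 1) / 2) + 12 := by
      rw [Finset.mul_sum]
      have : (12 : ℤ) = ∑ k : Fin 12, 1 := by simp
      rw [this, ← Finset.sum_add_distrib]
      refine Finset.sum_congr rfl fun k _ => ?_
      have h := d2_odd i k
      omega
    omega
  refine ⟨(∑ k, (d2M i k - 1) / 2) / 2, ?_⟩
  have h3 := congrArg (fun z : ℤ => (z : ℚ)) h2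
  simp only [Int.cast_mul, Int.cast_sum] at h3
  exact h3

lemma dvec_int (j : Fin 12) (x : Fin 12 → ℚ) (hx : x ∈ D12plus) :
    ∃ m : ℤ, ∑ k, x k * dvec j k = m := by
  unfold D12plus at hx
  induction hx using Submodule.span_induction with
  | mem x hx =>
    rcases hx with ⟨h1, m, h2⟩ | hx
    · choose n hn using h1
      refine ⟨∑ k, n k * ((d2M j k - 1) / 2) + m, ?_⟩
      have : ∀ k, x k * dvec j k = (n k : ℚ) * (((d2M j k - 1) / 2 : ℤ) : ℚ) + x k / 2 := by
        intro k
        have h := d2_odd j k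
        have h2 : d2M j k = 2 * ((d2M j k - 1) / 2) + 1 := by omega
        have h3 : (d2M j k : ℚ) = 2 * (((d2M j k - 1) / 2 : ℤ) : ℚ) + 1 := by exact_mod_cast h2
        simp only [dvec]
        rw [h3, hn k]; ring
      rw [Finset.sum_congr rfl fun k _ => this k, Finset.sum_add_distrib, ← Finset.sum_div, h2]
      push_cast
      ring
    · rw [Set.mem_singleton_iff] at hx
      subst hx
      refine ⟨(∑ k, d2M j k) / 4, ?_⟩
      have h : ∑ k, d2M j k = 4 * ((∑ k, d2M j k) / 4) := by have := d2_sum j; omega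
      have h3 : (∑ k, (d2M j k : ℚ)) = 4 * (((∑ k, d2M j k) / 4 : ℤ) : ℚ) := by exact_mod_cast h
      have : ∑ k, (1 : ℚ) / 2 * dvec j k = (∑ k, (d2M j k : ℚ)) / 4 := by
        rw [Finset.sum_div]
        refine Finset.sum_congr rfl fun k _ => ?_
        simp only [dvec]; ring
      rw [this, h3]; ring
  | zero => exact ⟨0, by simp⟩
  | add x y _ _ hx hy =>
    obtain ⟨m, hm⟩ := hx
    obtain ⟨n, hn⟩ := hy
    exact ⟨m + n, by simp [add_mul, Finset.sum_add_distrib, hm, hn]⟩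
  | smul a x _ hx =>
    obtain ⟨m, hm⟩ := hx
    refine ⟨a * m, ?_⟩
    push_cast
    rw [← hm, Finset.mul_sum]
    refine Finset.sum_congr rfl fun k _ => ?_
    simp; ring

/-- basis vectors as elements of the submodule -/
def dS (i : Fin 12) : ↥D12plus := ⟨dvec i, dvec_mem i⟩

lemma dS_li : LinearIndependent ℤ dS := by
  rw [Fintype.linearIndependent_iff]
  intro g hg i
  have h1 : ∀ j, ∑ i, g i * GdM i j = 0 := by
    intro j
    have h := congrArg (fun x : ↥D12plus => ∑ k, (x : Fin 12 → ℚ) k * dvec j k) hg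
    simp only [Submodule.coe_sum, Submodule.coe_smul, Finset.sum_apply, Pi.smul_apply,
      Submodule.coe_zero, Pi.zero_apply, zero_mul, Finset.sum_const_zero] at h
    have : ∑ k, (∑ c, g c • (dS c : Fin 12 → ℚ) k) * dvec j k = ∑ i, (g i : ℚ) * GdM i j := by
      simp_rw [Finset.sum_mul]
      rw [Finset.sum_comm]
      refine Finset.sum_congr rfl fun c _ => ?_
      rw [← dvec_dot, Finset.mul_sum]
      refine Finset.sum_congr rfl fun k _ => ?_
      simp [dS]; ring
    rw [this] at h
    exact_mod_cast h
  have h2 : g ᵥ* GdM = 0 := by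
    funext j; simpa [Matrix.vecMul, dotProduct] using h1 j
  have h3 : g = 0 := by
    have := congrArg (fun v => v ᵥ* GdI) h2
    simpa [Matrix.vecMul_vecMul, Gd_GdI] using this
  rw [h3]; rfl

lemma dS_span : ⊤ ≤ Submodule.span ℤ (Set.range dS) := by
  rintro ⟨x, hx⟩ -
  choose m hm using fun j => dvec_int j x hx
  have key : (⟨x, hx⟩ : ↥D12plus) = ∑ i, (∑ j, m j * GdI j i) • dS i := by
    apply Subtype.ext
    funext k
    simp only [Submodule.coe_sum, Submodule.coe_smul, Finset.sum_apply, Pi.smul_apply]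
    have hsp : ∀ a b, ∑ i, ∑ j, (d2M j a * GdI j i) * d2M i b = if a = b then 4 else 0 := by
      intro a b
      have := congrFun (congrFun d2_span a) b
      simp only [Matrix.mul_apply, Matrix.transpose_apply, Matrix.of_apply, Finset.sum_mul] at this
      exact this
    have hsp' : ∀ a b, ∑ i, ∑ j, ((d2M j a : ℚ) * GdI j i) * d2M i b = if a = b then 4 else 0 := by
      intro a b
      have := hsp a b
      have h2 := congrArg (fun z : ℤ => (z : ℚ)) this
      push_cast at h2
      exact h2
    have : ∑ i, (∑ j, m j * GdI j i) • (dS i : Fin 12 → ℚ) k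
        = ∑ a, x a / 4 * (∑ i, ∑ j, ((d2M j a : ℚ) * GdI j i) * d2M i k) := by
      simp_rw [Finset.mul_sum]
      rw [Finset.sum_comm]
      refine Finset.sum_congr rfl fun i _ => ?_
      rw [Finset.sum_comm, Finset.sum_smul]
      refine Finset.sum_congr rfl fun j _ => ?_
      rw [zsmul_eq_mul]
      push_cast
      rw [← hm j, Finset.sum_mul, Finset.sum_mul]
      refine Finset.sum_congr rfl fun a _ => ?_
      simp only [dS, dvec]; ring
    rw [this]
    simp_rw [hsp']
    simp
  rw [key]
  exact Submodule.sum_mem _ fun i _ => Submodule.smul_mem _ _ (Submodule.subset_span ⟨i, rfl⟩)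

/-- the basis of D12plus -/
noncomputable def bD : Basis (Fin 12) ℤ ↥D12plus := Basis.mk dS_li dS_span

lemma bD_apply (i : Fin 12) : bD i = dS i := by simp [bD]

lemma bLM_apply (x y : LM) : bLM x y = x ⬝ᵥ (GLM *ᵥ y) := rfl

lemma bLM_symm (x y : LM) : bLM x y = bLM y x := by
  rw [bLM_apply, bLM_apply, dotProduct_mulVec, ← mulVec_transpose, GLM_symm, dotProduct_comm]

lemma GLI_GLM : GLI * GLM = 1 := mul_eq_one_comm.mp GLM_GLI

lemma bLM_even (x : LM) : bLM x x % 2 = 0 := by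
  have hf : ∃ f : LM →ₗ[ℤ] ZMod 2, ∀ x, f x = ((bLM x x : ℤ) : ZMod 2) := by
    refine ⟨AddMonoidHom.toIntLinearMap ⟨⟨fun x => ((bLM x x : ℤ) : ZMod 2), by simp⟩, ?_⟩,
      fun x => rfl⟩
    intro x y
    simp only [map_add, LinearMap.add_apply]
    rw [bLM_symm y x]
    push_cast
    have : (2 : ZMod 2) = 0 := rfl
    linear_combination ((bLM x y : ℤ) : ZMod 2) * this
  obtain ⟨f, hf⟩ := hf
  have h0 : f = 0 := by
    apply LinearMap.pi_ext'
    intro i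
    ext
    have h2 := GLM_diag i
    simp only [LinearMap.comp_apply, LinearMap.single_apply, hf, bLM_apply]
    simp only [mulVec_single, single_dotProduct]
    simp
    rw [show (0 : ZMod 2) = ((0 : ℤ) : ZMod 2) by simp, ZMod.intCast_eq_intCast_iff]
    exact h2
  have := hf x
  rw [h0, LinearMap.zero_apply] at this
  have := (ZMod.intCast_zmod_eq_zero_iff_dvd (bLM x x) 2).mp this.symm
  omega

/-- representability of functionals -/
lemma bLM_repr (f : LM →ₗ[ℤ] ℤ) : ∃ l : LM, ∀ x, bLM l x = f x := by
  refine ⟨(fun i => f (Pi.single i 1)) ᵥ* GLI, fun x => ?_⟩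
  rw [bLM_apply, dotProduct_mulVec, vecMul_vecMul, GLI_GLM, vecMul_one]
  rw [LinearMap.pi_apply_eq_sum_univ f x]
  simp only [dotProduct]
  refine Finset.sum_congr rfl fun i _ => ?_
  rw [smul_eq_mul, mul_comm]
  congr 2
  funext j
  simp [Pi.single_apply, eq_comm]

/-- the cast to rational vectors -/
def jQ : LM →+ (MukaiIx → ℚ) where
  toFun x := fun i => (x i : ℚ)
  map_zero' := by funext i; simp
  map_add' x y := by funext i; simp

lemma jQ_apply (x : LM) (i : MukaiIx) : jQ x i = x i := rfl

lemma jQ_inj (x : LM) (h : jQ x = 0) : x = 0 := by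
  funext i
  have := congrFun h i
  rw [jQ_apply] at this
  simpa using this

/-- half the rational form -/
def BQ : (MukaiIx → ℚ) →ₗ[ℚ] (MukaiIx → ℚ) →ₗ[ℚ] ℚ :=
  LinearMap.mk₂ ℚ (fun x y => (1 / 2 : ℚ) * (x ⬝ᵥ (GLM.map (Int.cast : ℤ → ℚ) *ᵥ y)))
    (fun x x' y => by rw [add_dotProduct, mul_add])
    (fun c x y => by rw [smul_dotProduct, smul_eq_mul, smul_eq_mul]; ring)
    (fun x y y' => by rw [Matrix.mulVec_add, dotProduct_add, mul_add])
    (fun c x y => by rw [Matrix.mulVec_smul, dotProduct_smul, smul_eq_mul, smul_eq_mul]; ring)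

lemma BQ_apply (x y : MukaiIx → ℚ) :
    BQ x y = (1 / 2 : ℚ) * (x ⬝ᵥ (GLM.map (Int.cast : ℤ → ℚ) *ᵥ y)) := rfl

lemma BQ_symm (x y : MukaiIx → ℚ) : BQ x y = BQ y x := by
  have h : (GLM.map (Int.cast : ℤ → ℚ))ᵀ = GLM.map (Int.cast : ℤ → ℚ) := by
    rw [← Matrix.transpose_map, GLM_symm]
  rw [BQ_apply, BQ_apply, dotProduct_mulVec, ← mulVec_transpose, h, dotProduct_comm]

lemma BQ_jQ (x y : LM) : BQ (jQ x) (jQ y) = (bLM x y : ℚ) / 2 := by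
  rw [BQ_apply, bLM_apply]
  simp only [dotProduct, mulVec, Matrix.map_apply, jQ_apply]
  push_cast
  ring

lemma BQ_nondeg (x : MukaiIx → ℚ) (h : ∀ l : LM, BQ x (jQ l) = 0) : x = 0 := by
  have h1 : ∀ l : LM, x ⬝ᵥ (GLM.map (Int.cast : ℤ → ℚ) *ᵥ jQ l) = 0 := by
    intro l
    have := h l
    rw [BQ_apply] at this
    linarith
  funext i
  have h2 := h1 (GLI *ᵥ Pi.single i 1)
  have h3 : GLM.map (Int.cast : ℤ → ℚ) *ᵥ jQ (GLI *ᵥ Pi.single i 1) = Pi.single i 1 := by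
    have e : GLM *ᵥ (GLI *ᵥ Pi.single i 1) = Pi.single i 1 := by
      rw [mulVec_mulVec, GLM_GLI, one_mulVec]
    funext k
    have := congrArg (fun z : ℤ => (z : ℚ)) (congrFun e k)
    simp only [mulVec, dotProduct, Matrix.map_apply, jQ_apply, Int.cast_sum, Int.cast_mul,
      Pi.single_apply] at this ⊢
    rw [this]
    simp
  rw [h3] at h2
  simpa using h2

lemma gram_rows {I : Type*} [Fintype I] (F : Matrix I MukaiIx ℤ) (i j : I) :
    bLM (F i) (F j) = (F * GLM * Fᵀ) i j := by
  rw [bLM_apply, Matrix.mul_assoc]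
  simp only [dotProduct, mulVec, Matrix.mul_apply, Matrix.transpose_apply]

/-- the initial frame -/
lemma frame0 : IsFrame BQ (fun i => jQ (F0 i))
    (Sum.elim (fun _ => -1) (fun i => (epsv i : ℚ))) := by
  have hs : ∀ i, (Sum.elim (fun _ => -1) (fun i => (epsv i : ℚ)) : Fin 12 ⊕ Fin 12 → ℚ) i
      = (sgz i : ℚ) := by
    rintro (i | i) <;> simp [sgz]
  have hsq : ∀ i, sgz i * sgz i = 1 := by
    rintro (i | i)
    · simp [sgz]
    · simpa [sgz] using epsv_sq i
  constructor
  · intro i j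
    rw [BQ_jQ, gram_rows, F0_gram, hs, Matrix.diagonal_apply]
    split_ifs <;> simp
  · intro x hx
    -- rows of F0 rationally span
    have h2 : (GLM.map (Int.cast : ℤ → ℚ) * (F0.map (Int.cast : ℤ → ℚ))ᵀ *
        Matrix.diagonal (fun i => (sgz i : ℚ) / 2)) * F0.map (Int.cast : ℤ → ℚ) = 1 := by
      refine (Matrix.mul_eq_one_comm_of_card_eq (R := ℚ) (m := Fin 12 ⊕ Fin 12) (n := MukaiIx)
        (by simp)).mp ?_
      have h3 := congrArg (fun M : Matrix (Fin 12 ⊕ Fin 12) (Fin 12 ⊕ Fin 12) ℤ =>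
        M.map (Int.castRingHom ℚ)) F0_gram
      simp only [Matrix.map_mul] at h3
      change F0.map (Int.cast : ℤ → ℚ) * GLM.map (Int.cast : ℤ → ℚ) * (F0.map (Int.cast : ℤ → ℚ))ᵀ
        = _ at h3
      rw [← Matrix.mul_assoc, ← Matrix.mul_assoc, h3,
        Matrix.diagonal_map (by simp), Matrix.diagonal_mul_diagonal, ← Matrix.diagonal_one]
      congr 1
      funext i
      have : ((sgz i : ℚ)) * sgz i = 1 := by exact_mod_cast hsq i
      simp
      linarith
    have h4 : ∀ i, (x ᵥ* (GLM.map (Int.cast : ℤ → ℚ) * (F0.map (Int.cast : ℤ → ℚ))ᵀ)) i = 0 := by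
      intro i
      have := hx i
      rw [BQ_apply] at this
      rw [← vecMul_vecMul]
      rw [dotProduct_mulVec] at this
      simp only [Matrix.vecMul, dotProduct, Matrix.transpose_apply, Matrix.map_apply, jQ_apply]
        at this ⊢
      linarith
    have h5 : x ᵥ* (GLM.map (Int.cast : ℤ → ℚ) * (F0.map (Int.cast : ℤ → ℚ))ᵀ) = 0 := funext h4
    rw [← vecMul_one x, ← h2, ← vecMul_vecMul, ← vecMul_vecMul, h5]
    simp

/-- moving a partial frame to given vectors -/
lemma frame_move {V : Type*} [AddCommGroup V] [Module ℚ V]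
    {B : V →ₗ[ℚ] V →ₗ[ℚ] ℚ} (hs : ∀ x y, B x y = B y x) {e : Fin 12 ⊕ Fin 12 → V}
    {sg : Fin 12 ⊕ Fin 12 → ℚ}
    (h : IsFrame B e sg) (hsg : ∀ i, sg i ≠ 0) (a : Fin 12 → V)
    (ha : ∀ i j, B (a i) (a j) = if i = j then sg (Sum.inl i) else 0) :
    ∃ e' : Fin 12 ⊕ Fin 12 → V, IsFrame B e' sg ∧ ∀ i, e' (Sum.inl i) = a i := by
  have main : ∀ k, k ≤ 12 → ∃ e' : Fin 12 ⊕ Fin 12 → V, IsFrame B e' sg ∧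
      ∀ i : Fin 12, i.val < k → e' (Sum.inl i) = a i := by
    intro k
    induction k with
    | zero => intro _; exact ⟨e, h, fun i hi => absurd hi (by omega)⟩
    | succ k ih =>
      intro hk
      obtain ⟨e1, f1, f2⟩ := ih (by omega)
      obtain ⟨e2, g1, g2, g3⟩ := witt hs f1 hsg (fun i => ∃ i' : Fin 12, i'.val < k ∧ i = Sum.inl i')
        (Sum.inl ⟨k, by omega⟩) (by
          rintro ⟨i', h1, h2⟩
          have := Sum.inl.inj h2
          rw [← this] at h1
          simp at h1) (a ⟨k, by omega⟩) (by rw [ha]; simp) (by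
          rintro _ ⟨i', h1, rfl⟩
          rw [f2 i' h1, ha, if_neg]
          intro h
          rw [← h] at h1
          simp at h1)
      refine ⟨e2, g1, fun i hi => ?_⟩
      by_cases c : i.val < k
      · rw [g2 _ ⟨i, c, rfl⟩, f2 i c]
      · have : i = ⟨k, by omega⟩ := Fin.ext (by simp; omega)
        rw [this, g3]
  obtain ⟨e', h1, h2⟩ := main 12 le_rfl
  exact ⟨e', h1, fun i => h2 i i.isLt⟩

lemma lag (S K : Fin 12 → LM) (hS : ∀ i j, bLM (S i) (S j) = -2 * GdM i j)
    (hK : ∀ i j, bLM (K i) (S j) = if i = j then 1 else 0) (y : LM) (hy : ∀ j, bLM y (S j) = 0) :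
    ∃ c : Fin 12 → ℤ, ∃ z : LM, y = ∑ i, c i • S i + (2 : ℤ) • z := by
  let XZ : Matrix (Fin 12 ⊕ Fin 12) MukaiIx ℤ := Matrix.of (Sum.elim S K)
  let φ : ℤ →+* ZMod 2 := Int.castRingHom (ZMod 2)
  let H : Matrix (Fin 12) (Fin 12) (ZMod 2) := Matrix.of fun i j => φ (bLM (K i) (K j))
  let J : Matrix (Fin 12 ⊕ Fin 12) (Fin 12 ⊕ Fin 12) (ZMod 2) := Matrix.fromBlocks (-H) 1 1 0
  have two : φ 2 = 0 := rfl
  have hX : XZ.map φ * GLM.map φ * (XZ.map φ)ᵀ = Matrix.fromBlocks 0 1 1 H := by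
    rw [← Matrix.transpose_map, ← Matrix.map_mul, ← Matrix.map_mul]
    ext i j
    rw [Matrix.map_apply, ← gram_rows]
    rcases i with i | i <;> rcases j with j | j
    · change φ (bLM (S i) (S j)) = 0
      rw [hS, map_mul, map_neg, two]; simp
    · change φ (bLM (S i) (K j)) = (1 : Matrix (Fin 12) (Fin 12) (ZMod 2)) i j
      rw [bLM_symm, hK, Matrix.one_apply]
      by_cases h : i = j
      · subst h; simp
      · rw [if_neg h, if_neg (Ne.symm h)]; simp
    · change φ (bLM (K i) (S j)) = (1 : Matrix (Fin 12) (Fin 12) (ZMod 2)) i j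
      rw [hK, Matrix.one_apply]
      split_ifs <;> simp
    · rfl
  have h1 : XZ.map φ * (GLM.map φ * (XZ.map φ)ᵀ * J) = 1 := by
    rw [← Matrix.mul_assoc, ← Matrix.mul_assoc, hX, Matrix.fromBlocks_multiply]
    simp [Matrix.fromBlocks_one]
  have h2 : (GLM.map φ * (XZ.map φ)ᵀ * J) * XZ.map φ = 1 :=
    (Matrix.mul_eq_one_comm_of_card_eq (R := ZMod 2) (m := Fin 12 ⊕ Fin 12) (n := MukaiIx)
      (by simp)).mp h1
  let yb : MukaiIx → ZMod 2 := fun i => φ (y i)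
  have h3 : yb ᵥ* (GLM.map φ * (XZ.map φ)ᵀ) =
      Sum.elim (0 : Fin 12 → ZMod 2) (fun i => φ (bLM y (K i))) := by
    have gen : ∀ j, (yb ᵥ* (GLM.map φ * (XZ.map φ)ᵀ)) j = φ (bLM y (XZ j)) := by
      intro j
      rw [bLM_apply, dotProduct_mulVec, ← vecMul_vecMul]
      simp only [Matrix.vecMul, dotProduct, Matrix.transpose_apply, Matrix.map_apply, yb,
        map_sum, map_mul]
    funext j
    rw [gen]
    rcases j with j | j
    · change φ (bLM y (S j)) = 0
      rw [hy]; simp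
    · rfl
  have hJ : ∀ c : Fin 12 → ZMod 2, Sum.elim (0 : Fin 12 → ZMod 2) c ᵥ* J
      = Sum.elim c (0 : Fin 12 → ZMod 2) := by
    intro c
    rw [Matrix.vecMul_fromBlocks]
    simp
  have h4 : yb = (Sum.elim (fun i => φ (bLM y (K i))) (0 : Fin 12 → ZMod 2)) ᵥ* XZ.map φ := by
    rw [← hJ, ← h3, vecMul_vecMul, vecMul_vecMul, ← Matrix.mul_assoc, h2, vecMul_one]
  have h5 : ∀ p, ∃ w : ℤ, y p - (∑ i, bLM y (K i) • S i) p = 2 * w := by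
    intro p
    have := congrFun h4 p
    simp only [Matrix.vecMul, dotProduct, Fintype.sum_sum_type, Sum.elim_inl, Sum.elim_inr,
      Pi.zero_apply, zero_mul, Finset.sum_const_zero, add_zero, Matrix.map_apply, yb] at this
    have e : φ (y p - (∑ i, bLM y (K i) • S i) p) = 0 := by
      rw [map_sub, this, sub_eq_zero, Finset.sum_apply, map_sum]
      refine Finset.sum_congr rfl fun i _ => ?_
      rw [Pi.smul_apply, smul_eq_mul, map_mul]; rfl
    obtain ⟨w, hw⟩ := (ZMod.intCast_zmod_eq_zero_iff_dvd _ 2).mp e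
    exact ⟨w, by exact_mod_cast hw⟩
  choose z hz using h5
  refine ⟨fun i => bLM y (K i), z, ?_⟩
  funext p
  have := hz p
  simp only [Pi.add_apply, Pi.smul_apply, smul_eq_mul]
  linarith

/-- the complement of a family -/
def Tsub (S : Fin 12 → LM) : Submodule ℤ LM where
  carrier := {x | ∀ j, bLM x (S j) = 0}
  add_mem' := by
    intro a c ha hc j
    rw [map_add, LinearMap.add_apply, ha j, hc j, add_zero]
  zero_mem' := by intro j; simp
  smul_mem' := by
    intro k x hx j
    rw [_root_.map_smul, LinearMap.smul_apply, hx j, smul_zero]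

lemma bT_even (S K : Fin 12 → LM) (hS : ∀ i j, bLM (S i) (S j) = -2 * GdM i j)
    (hK : ∀ i j, bLM (K i) (S j) = if i = j then 1 else 0) (x y : LM) (hx : ∀ j, bLM x (S j) = 0)
    (hy : ∀ j, bLM y (S j) = 0) : 2 * (bLM x y / 2) = bLM x y := by
  obtain ⟨c, z, rfl⟩ := lag S K hS hK y hy
  have : bLM x (∑ i, c i • S i + (2 : ℤ) • z) = 2 * bLM x z := by
    rw [map_add, map_sum, map_smul, smul_eq_mul]
    simp only [map_smul, hx, smul_zero, Finset.sum_const_zero, zero_add]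
  rw [this]; omega

lemma bT_ex (S K : Fin 12 → LM) (hS : ∀ i j, bLM (S i) (S j) = -2 * GdM i j)
    (hK : ∀ i j, bLM (K i) (S j) = if i = j then 1 else 0) :
    ∃ β : Tsub S →ₗ[ℤ] Tsub S →ₗ[ℤ] ℤ, ∀ x y : Tsub S, bLM (x : LM) y = 2 * β x y := by
  have ev := fun x y : Tsub S => bT_even S K hS hK x y x.2 y.2
  refine ⟨LinearMap.mk₂ ℤ (fun x y => bLM (x : LM) y / 2) ?_ ?_ ?_ ?_, fun x y => (ev x y).symm⟩
  · intro x x' y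
    have h1 := ev x y; have h2 := ev x' y
    have h3 : bLM ((x + x' : Tsub S) : LM) y = bLM (x : LM) y + bLM (x' : LM) y := by
      rw [Submodule.coe_add, map_add, LinearMap.add_apply]
    rw [h3]; omega
  · intro c x y
    have h1 := ev x y
    have h3 : bLM ((c • x : Tsub S) : LM) y = c * bLM (x : LM) y := by
      rw [Submodule.coe_smul, map_smul, LinearMap.smul_apply, smul_eq_mul]
    rw [h3, ← h1, smul_eq_mul, mul_left_comm, Int.mul_ediv_cancel_left _ (by norm_num), h1]
  · intro x y y'
    have h1 := ev x y; have h2 := ev x y'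
    have h3 : bLM (x : LM) ((y + y' : Tsub S) : LM) = bLM (x : LM) y + bLM (x : LM) y' := by
      rw [Submodule.coe_add, map_add]
    rw [h3]; omega
  · intro c x y
    have h1 := ev x y
    have h3 : bLM (x : LM) ((c • y : Tsub S) : LM) = c * bLM (x : LM) y := by
      rw [Submodule.coe_smul, map_smul, smul_eq_mul]
    rw [h3, ← h1, smul_eq_mul, mul_left_comm, Int.mul_ediv_cancel_left _ (by norm_num), h1]

/-- projection of twice a vector -/
lemma two_proj (S : Fin 12 → LM) (hS : ∀ i j, bLM (S i) (S j) = -2 * GdM i j) (l : LM) :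
    ∃ c : Fin 12 → ℤ, ∀ j, bLM ((2 : ℤ) • l - ∑ i, c i • S i) (S j) = 0 := by
  refine ⟨fun i => - ((fun k => bLM l (S k)) ᵥ* GdI) i, fun j => ?_⟩
  have h : ((fun k => bLM l (S k)) ᵥ* GdI) ᵥ* GdM = fun k => bLM l (S k) := by
    rw [vecMul_vecMul, GdI_Gd, vecMul_one]
  have h' := congrFun h j
  simp only [map_sub, map_sum, map_smul, LinearMap.sub_apply, LinearMap.sum_apply,
    LinearMap.smul_apply, smul_eq_mul, hS]
  set v := (fun k => bLM l (S k)) ᵥ* GdI with hv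
  have e : ∑ i, -v i * (-2 * GdM i j) = 2 * (v ᵥ* GdM) j := by
    simp only [Matrix.vecMul, dotProduct, Finset.mul_sum]
    refine Finset.sum_congr rfl fun k _ => ?_
    ring
  rw [e, h']; ring

lemma prim_part (v : LM) (hv : v ≠ 0) :
    ∃ c : ℤ, c ≠ 0 ∧ ∃ v0 l : LM, v = c • v0 ∧ bLM v0 l = 1 := by
  obtain ⟨g, hg, hne⟩ : ∃ g : MukaiIx → ℤ, (∀ i, v i = Finset.univ.gcd v * g i) ∧ Finset.univ.gcd g = 1 := by
    obtain ⟨i, hi⟩ := Function.ne_iff.mp hv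
    obtain ⟨g, h1, h2⟩ := Finset.extract_gcd v (s := Finset.univ) ⟨i, Finset.mem_univ i⟩
    exact ⟨g, fun i => h1 i (Finset.mem_univ i), h2⟩
  refine ⟨Finset.univ.gcd v, ?_, g, ?_⟩
  · intro h
    apply hv
    funext i
    rw [hg i, h]; simp
  · have : ∃ a : MukaiIx → ℤ, ∑ i, a i * g i = 1 := by
      have h1 : (1 : ℤ) ∈ Ideal.span (Set.range g) := by
        rw [Submodule.IsPrincipal.mem_iff_generator_dvd, ← hne]
        refine Finset.dvd_gcd fun i _ => ?_
        rw [← Submodule.IsPrincipal.mem_iff_generator_dvd]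
        exact Ideal.subset_span ⟨i, rfl⟩
      obtain ⟨a, ha⟩ := (Ideal.mem_span_range_iff_exists_fun).mp h1
      exact ⟨a, ha⟩
    obtain ⟨a, ha⟩ := this
    refine ⟨GLI *ᵥ a, ?_, ?_⟩
    · funext i; rw [hg i]; rfl
    · rw [bLM_apply, mulVec_mulVec, GLM_GLI, one_mulVec, dotProduct_comm]
      exact ha

/-- clearing denominators -/
lemma clear_den (x : MukaiIx → ℚ) : ∃ m : ℚ, m ≠ 0 ∧ ∃ y : LM, jQ y = m • x := by
  obtain ⟨b, hb⟩ := IsLocalization.exist_integer_multiples_of_finite (nonZeroDivisors ℤ) x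
  choose y hy using hb
  refine ⟨((b : ℤ) : ℚ), ?_, y, ?_⟩
  · exact_mod_cast nonZeroDivisors.ne_zero b.2
  · funext i
    have := hy i
    simp only [Pi.smul_apply, jQ_apply, smul_eq_mul] at this ⊢
    simpa using this

/-- coefficients of twice the coordinate vectors -/
def nM : Matrix (Fin 12) (Fin 12) ℤ := d2Mᵀ * GdI

lemma GdI_symm : GdIᵀ = GdI := by decide +kernel

lemma nM_gram (i j : Fin 12) :
    ∑ k, ∑ l, nM i k * nM j l * GdM k l = if i = j then 4 else 0 := by
  have h : nM * GdM * nMᵀ = Matrix.of (fun i j => if i = j then 4 else 0) := by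
    rw [nM, Matrix.mul_assoc d2Mᵀ, GdI_Gd, Matrix.mul_one, Matrix.transpose_mul, GdI_symm,
      Matrix.transpose_transpose, ← Matrix.mul_assoc, d2_span]
  have h2 := congrFun (congrFun h i) j
  simp only [Matrix.mul_apply, Matrix.transpose_apply, Matrix.of_apply, Finset.sum_mul] at h2
  rw [← h2, Finset.sum_comm]
  refine Finset.sum_congr rfl fun l _ => Finset.sum_congr rfl fun k _ => ?_
  ring

lemma d2_nM (j k : Fin 12) : ∑ i, d2M j i * nM i k = if j = k then 4 else 0 := by
  have h : d2M * nM = (4 : ℤ) • (1 : Matrix (Fin 12) (Fin 12) ℤ) := by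
    have e : d2M * d2Mᵀ = (4 : ℤ) • GdM := by
      ext a b
      simp only [Matrix.mul_apply, Matrix.transpose_apply, Matrix.smul_apply, smul_eq_mul]
      exact d2_Gd a b
    rw [nM, ← Matrix.mul_assoc, e, Matrix.smul_mul, Gd_GdI]
  have h2 := congrFun (congrFun h j) k
  simp only [Matrix.mul_apply, Matrix.smul_apply, Matrix.one_apply, smul_eq_mul] at h2
  rw [h2]; split_ifs <;> rfl

lemma struct_lem (S K : Fin 12 → LM) (hS : ∀ i j, bLM (S i) (S j) = -2 * GdM i j)
    (hK : ∀ i j, bLM (K i) (S j) = if i = j then 1 else 0) :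
    ∃ h : Fin 12 → LM, (∀ i j, bLM (h i) (S j) = - GdM i j) ∧
      (∀ i j, bLM ((2 : ℤ) • h i - S i) ((2 : ℤ) • h j - S j) = if i = j then 2 * epsv i else 0) ∧
      (∀ x, (∀ j, bLM x (S j) = 0) → (∀ i, bLM x ((2 : ℤ) • h i - S i) = 0) → x = 0) := by
  obtain ⟨β, hβ⟩ := bT_ex S K hS hK
  let h0 : Fin 12 → LM := fun i => - ∑ k, GdM i k • K k
  have hh0 : ∀ i j, bLM (h0 i) (S j) = - GdM i j := by
    intro i j
    simp only [h0, map_neg, map_sum, LinearMap.neg_apply, LinearMap.sum_apply, map_smul,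
      LinearMap.smul_apply, hK, smul_eq_mul, mul_ite, mul_one, mul_zero]
    simp
  have hsm : ∀ i, (2 : ℤ) • h0 i - S i ∈ Tsub S := by
    intro i j
    rw [map_sub, map_smul, LinearMap.sub_apply, LinearMap.smul_apply, hh0, hS, smul_eq_mul]
    ring
  let s : Fin 12 → Tsub S := fun i => ⟨(2 : ℤ) • h0 i - S i, hsm i⟩
  have hbs : ∀ i j, β (s i) (s j) = 2 * bLM (h0 i) (h0 j) + GdM i j := by
    intro i j
    have h1 := hβ (s i) (s j)
    have h2 : bLM ((2 : ℤ) • h0 i - S i) ((2 : ℤ) • h0 j - S j)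
        = 4 * bLM (h0 i) (h0 j) + 2 * GdM i j := by
      have hsy : GdM j i = GdM i j := by
        have := congrFun (congrFun Gd_symm i) j
        simpa using this
      simp only [map_sub, map_smul, LinearMap.sub_apply, LinearMap.smul_apply, smul_eq_mul, hS, hh0]
      rw [bLM_symm (S i) (h0 j), hh0, hsy]
      ring
    change bLM ((2 : ℤ) • h0 i - S i) ((2 : ℤ) • h0 j - S j) = _ at h1
    rw [h2] at h1
    linarith
  let a : Fin 12 → MukaiIx → ℚ := fun i => (1 / 2 : ℚ) • ∑ k, (nM i k : ℚ) • jQ (S k)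
  have haB : ∀ x i, BQ x (a i) = (1 / 2 : ℚ) * ∑ k, (nM i k : ℚ) * BQ x (jQ (S k)) := by
    intro x i
    simp only [a, map_smul, map_sum, smul_eq_mul]
  have ha : ∀ i j, BQ (a i) (a j) = if i = j then -1 else 0 := by
    intro i j
    rw [haB]
    have e1 : ∀ k, BQ (a i) (jQ (S k)) = - (1 / 2 : ℚ) * ∑ l, (nM i l : ℚ) * GdM l k := by
      intro k
      rw [BQ_symm, haB, neg_mul, ← mul_neg, ← Finset.sum_neg_distrib]
      congr 1
      refine Finset.sum_congr rfl fun l _ => ?_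
      rw [BQ_symm, BQ_jQ, hS]
      push_cast; ring
    simp_rw [e1]
    have e2 := congrArg (fun z : ℤ => (z : ℚ)) (nM_gram i j)
    simp only [Int.cast_sum, Int.cast_mul] at e2
    have e3 : ∑ k, (nM j k : ℚ) * (-(1 / 2 : ℚ) * ∑ l, (nM i l : ℚ) * GdM l k)
        = -(1 / 2 : ℚ) * ∑ k, ∑ l, (nM i k : ℚ) * nM j l * GdM k l := by
      rw [Finset.sum_comm, Finset.mul_sum]
      refine Finset.sum_congr rfl fun k _ => ?_
      rw [Finset.mul_sum, Finset.mul_sum, Finset.mul_sum]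
      refine Finset.sum_congr rfl fun l _ => ?_
      ring
    rw [e3, e2]
    split_ifs <;> norm_num
  have hSa : ∀ x, (∀ i, BQ x (a i) = 0) → ∀ j, BQ x (jQ (S j)) = 0 := by
    intro x hx j
    have e1 : ∀ i, ∑ k, (nM i k : ℚ) * BQ x (jQ (S k)) = 0 := by
      intro i
      have := hx i
      rw [haB] at this
      linarith
    have e2 : ∑ i, (d2M j i : ℚ) * ∑ k, (nM i k : ℚ) * BQ x (jQ (S k)) = 0 := by
      simp only [e1, mul_zero, Finset.sum_const_zero]
    have e3 : ∑ i, (d2M j i : ℚ) * ∑ k, (nM i k : ℚ) * BQ x (jQ (S k))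
        = ∑ k, (∑ i, (d2M j i : ℚ) * nM i k) * BQ x (jQ (S k)) := by
      simp_rw [Finset.mul_sum, Finset.sum_mul]
      rw [Finset.sum_comm]
      refine Finset.sum_congr rfl fun k _ => Finset.sum_congr rfl fun l _ => ?_
      ring
    have e4 : ∀ k, ∑ i, (d2M j i : ℚ) * nM i k = if j = k then 4 else 0 := by
      intro k
      have := congrArg (fun z : ℤ => (z : ℚ)) (d2_nM j k)
      simp only [Int.cast_sum, Int.cast_mul] at this
      rw [this]; split_ifs <;> simp
    rw [e3] at e2
    simp_rw [e4] at e2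
    simpa using e2
  obtain ⟨e, he, hea⟩ := frame_move BQ_symm frame0 (by
    rintro (i | i)
    · simp
    · have := epsv_sq i
      simp only [Sum.elim_inr]
      intro h
      have h0 : epsv i = 0 := by exact_mod_cast h
      rw [h0] at this; simp at this) a (by
    intro i j; rw [ha]; rfl)
  obtain ⟨t, ht1, ht2, ht3⟩ := peel β BQ (jQ.comp (Tsub S).subtype.toAddMonoidHom) a s
    (by
      intro x y
      have h1 := hβ x y
      have h2 := hβ y x
      rw [bLM_symm] at h2
      linarith)
    BQ_symm
    (by
      intro v hv
      have hv' : (v : LM) ≠ 0 := fun h => hv (Subtype.ext h)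
      obtain ⟨c, hc, v0, l, h1, h2⟩ := prim_part v hv'
      have hv0 : v0 ∈ Tsub S := by
        intro j
        have := v.2 j
        rw [h1, map_smul, LinearMap.smul_apply, smul_eq_mul] at this
        exact (mul_eq_zero.mp this).resolve_left hc
      obtain ⟨d, hd⟩ := two_proj S hS l
      refine ⟨c, ⟨v0, hv0⟩, ⟨_, hd⟩, Subtype.ext h1, ?_⟩
      have h3 := hβ ⟨v0, hv0⟩ ⟨_, hd⟩
      have h4 : bLM v0 ((2 : ℤ) • l - ∑ i, d i • S i) = 2 := by
        simp only [map_sub, map_sum, map_smul, h2, hv0 _, smul_zero, Finset.sum_const_zero]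
        simp
      rw [h4] at h3
      linarith)
    (by
      intro x y
      change BQ (jQ x) (jQ y) = _
      rw [BQ_jQ, hβ]; push_cast; ring)
    (by
      intro x i
      change BQ (jQ x) (a i) = 0
      rw [haB]
      have : ∀ k, BQ (jQ x) (jQ (S k)) = 0 := by
        intro k
        rw [BQ_jQ, x.2 k]; simp
      simp [this])
    (by
      intro x hx
      obtain ⟨m, hm, y, hy⟩ := clear_den x
      refine ⟨m, hm, ⟨y, ?_⟩, hy⟩
      intro j
      have h1 := BQ_jQ y (S j)
      rw [hy, map_smul, LinearMap.smul_apply, hSa x hx j, smul_zero] at h1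
      have : (bLM y (S j) : ℚ) = 0 := by linarith
      exact_mod_cast this)
    (by
      intro i
      rw [hbs]
      have h1 := bLM_even (h0 i)
      have h2 := Gd_diag i
      omega)
    (by
      intro i i' hne
      rw [hbs]
      have h2 := Gd_off i i' hne
      omega)
    (by
      intro x hx
      exact Subtype.ext (jQ_inj _ hx))
    e he hea
  choose u hu using ht1
  have key : ∀ i, (2 : ℤ) • (h0 i + (u i : LM)) - S i = (t i : LM) := by
    intro i
    rw [hu i, Submodule.coe_add, Submodule.coe_smul]
    change _ = (2 : ℤ) • h0 i - S i + _
    rw [smul_add]; abel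
  refine ⟨fun i => h0 i + (u i : LM), ?_, ?_, ?_⟩
  · intro i j
    rw [map_add, LinearMap.add_apply, hh0, (u i).2 j, add_zero]
  · intro i j
    simp only [key]
    rw [hβ, ht2]
    split_ifs <;> simp
  · intro x hx hx2
    have := ht3 ⟨x, hx⟩ (by
      intro i
      have h1 := hx2 i
      simp only [key] at h1
      have h2 := hβ ⟨x, hx⟩ (t i)
      rw [h1] at h2
      linarith)
    exact congrArg Subtype.val this

lemma part1 : ∃ ι : ↥D12plus →ₗ[ℤ] LM, IsPrimD12Embedding ι := by
  let ι : ↥D12plus →ₗ[ℤ] LM := bD.constr ℤ (fun i => E0 i)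
  have hι : ∀ i, ι (bD i) = E0 i := fun i => bD.constr_basis ℤ _ i
  let ρ : LM →ₗ[ℤ] ↥D12plus := bD.equivFun.symm.toLinearMap ∘ₗ R0.vecMulLinear
  have hρ : ρ ∘ₗ ι = LinearMap.id := by
    apply bD.ext
    intro i
    rw [LinearMap.comp_apply, hι]
    change bD.equivFun.symm (E0 i ᵥ* R0) = bD i
    have : E0 i ᵥ* R0 = Pi.single i 1 := by
      have h := congrFun E0_R0 i
      rw [← Matrix.mul_apply_eq_vecMul, h]
      funext j
      rw [Matrix.one_apply, Pi.single_apply]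
      simp [eq_comm]
    rw [this]
    simp [Basis.equivFun_symm_apply, Pi.single_apply]
  have hρ' : ∀ s, ρ (ι s) = s := fun s => LinearMap.congr_fun hρ s
  refine ⟨ι, ?_, ?_, ?_⟩
  · intro x y h
    rw [← hρ' x, h, hρ']
  · let F1 : ↥D12plus →ₗ[ℤ] ↥D12plus →ₗ[ℤ] ℚ := LinearMap.mk₂ ℤ
      (fun s s' => (bLM (ι s) (ι s') : ℚ))
      (by intro x y z; simp)
      (by intro c x y; rw [map_smul, map_smul, LinearMap.smul_apply, smul_eq_mul, Int.cast_mul,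
            zsmul_eq_mul])
      (by intro x y z; simp)
      (by intro c x y; rw [map_smul, map_smul, smul_eq_mul, Int.cast_mul, zsmul_eq_mul])
    let F2 : ↥D12plus →ₗ[ℤ] ↥D12plus →ₗ[ℤ] ℚ := LinearMap.mk₂ ℤ
      (fun s s' => -2 * ∑ i, (s : Fin 12 → ℚ) i * (s' : Fin 12 → ℚ) i)
      (by intro x y z; simp [add_mul, Finset.sum_add_distrib]; ring)
      (by intro c x y; simp [mul_assoc, mul_left_comm _ (c : ℚ), ← Finset.mul_sum])
      (by intro x y z; simp [mul_add, Finset.sum_add_distrib])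
      (by intro c x y; simp [mul_left_comm _ (c : ℚ), ← Finset.mul_sum])
    have hF : F1 = F2 := by
      refine bD.ext fun i => bD.ext fun j => ?_
      change (bLM (ι (bD i)) (ι (bD j)) : ℚ) =
        -2 * ∑ k, (bD i : Fin 12 → ℚ) k * (bD j : Fin 12 → ℚ) k
      rw [hι, hι, gram_rows, E0_gram, bD_apply, bD_apply]
      change _ = -2 * ∑ k, dvec i k * dvec j k
      rw [dvec_dot]
      simp
    intro s s'
    exact LinearMap.congr_fun (LinearMap.congr_fun hF s) s'
  · rintro x k hk ⟨s, hs⟩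
    refine ⟨ρ x, ?_⟩
    have h1 : s = k • ρ x := by rw [← hρ' s, hs, map_smul]
    rw [h1, map_smul] at hs
    exact smul_right_injective LM hk hs

lemma dual_ex (ι : ↥D12plus →ₗ[ℤ] LM) (h : IsPrimD12Embedding ι) :
    ∃ K : Fin 12 → LM, ∀ i j, bLM (K i) (ι (bD j)) = if i = j then 1 else 0 := by
  obtain ⟨hinj, -, hprim⟩ := h
  let p := LinearMap.range ι
  have tf : IsTorsionFree ℤ (LM ⧸ p) := by
    refine Module.IsTorsionFree.of_smul_eq_zero fun r m hm => ?_
    obtain ⟨x, rfl⟩ := p.mkQ_surjective m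
    by_cases hr : r = 0
    · exact Or.inl hr
    · right
      rw [← map_smul, Submodule.mkQ_apply, Submodule.Quotient.mk_eq_zero] at hm
      rw [Submodule.mkQ_apply, Submodule.Quotient.mk_eq_zero]
      exact hprim x r hr hm
  have fr : Module.Free ℤ (LM ⧸ p) := Module.free_of_finite_type_torsion_free'
  obtain ⟨σ, hσ⟩ := Module.projective_lifting_property p.mkQ LinearMap.id p.mkQ_surjective
  have hσ' : ∀ m, p.mkQ (σ m) = m := fun m => LinearMap.congr_fun hσ m
  have hmem : ∀ x, (LinearMap.id - σ ∘ₗ p.mkQ : LM →ₗ[ℤ] LM) x ∈ p := by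
    intro x
    rw [← Submodule.Quotient.mk_eq_zero, ← Submodule.mkQ_apply]
    simp only [LinearMap.sub_apply, LinearMap.id_apply, LinearMap.comp_apply, map_sub, hσ']
    simp
  let r : LM →ₗ[ℤ] ↥D12plus := (LinearEquiv.ofInjective ι hinj).symm.toLinearMap ∘ₗ
    LinearMap.codRestrict p (LinearMap.id - σ ∘ₗ p.mkQ) hmem
  have hr : ∀ s, r (ι s) = s := by
    intro s
    change (LinearEquiv.ofInjective ι hinj).symm _ = s
    rw [LinearEquiv.symm_apply_eq]
    apply Subtype.ext
    have : p.mkQ (ι s) = 0 := by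
      rw [Submodule.mkQ_apply, Submodule.Quotient.mk_eq_zero]; exact ⟨s, rfl⟩
    simp only [LinearMap.codRestrict_apply, LinearMap.sub_apply, LinearMap.id_apply,
      LinearMap.comp_apply, this, map_zero, sub_zero]
    rfl
  choose K hK using fun i => bLM_repr (bD.coord i ∘ₗ r)
  refine ⟨K, fun i j => ?_⟩
  rw [hK, LinearMap.comp_apply, hr, Basis.coord_apply, Basis.repr_self, Finsupp.single_apply]
  simp only [eq_comm]

lemma struct_iota (ι : ↥D12plus →ₗ[ℤ] LM) (hp : IsPrimD12Embedding ι) :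
    ∃ h t : Fin 12 → LM, (∀ i j, bLM (ι (bD i)) (ι (bD j)) = -2 * GdM i j) ∧
      (∀ i j, bLM (h i) (ι (bD j)) = - GdM i j) ∧
      (∀ i, t i = (2 : ℤ) • h i - ι (bD i)) ∧
      (∀ i j, bLM (t i) (ι (bD j)) = 0) ∧
      (∀ i j, bLM (t i) (t j) = if i = j then 2 * epsv i else 0) ∧
      (∀ x, (∀ j, bLM x (ι (bD j)) = 0) → ∃ c : Fin 12 → ℤ, x = ∑ i, c i • t i) ∧
      ∃ b : Basis (Fin 12 ⊕ Fin 12) ℤ LM, ∀ i, b i = Sum.elim (fun i => ι (bD i)) h i := by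
  obtain ⟨K, hK⟩ := dual_ex ι hp
  obtain ⟨hinj, hgram, -⟩ := hp
  have hS : ∀ i j, bLM (ι (bD i)) (ι (bD j)) = -2 * GdM i j := by
    intro i j
    have h1 := hgram (bD i) (bD j)
    rw [bD_apply i, bD_apply j] at h1 ⊢
    change _ = -2 * ∑ k, dvec i k * dvec j k at h1
    rw [dvec_dot] at h1
    exact_mod_cast h1
  set S : Fin 12 → LM := fun i => ι (bD i) with hSdef
  obtain ⟨h, h1, h2, h3⟩ := struct_lem S K hS hK
  obtain ⟨t, ht⟩ : ∃ t : Fin 12 → LM, ∀ i, t i = (2 : ℤ) • h i - S i := ⟨_, fun _ => rfl⟩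
  simp only [← ht] at h2 h3
  have htS : ∀ i j, bLM (t i) (S j) = 0 := by
    intro i j
    rw [ht, map_sub, map_smul, LinearMap.sub_apply, LinearMap.smul_apply, h1, hS, smul_eq_mul]
    ring
  have hspanT : ∀ x, (∀ j, bLM x (S j) = 0) → ∃ c : Fin 12 → ℤ, x = ∑ i, c i • t i := by
    intro x hx
    refine ⟨fun i => epsv i * (bLM x (t i) / 2), ?_⟩
    rw [← sub_eq_zero]
    apply h3
    · intro j
      simp only [map_sub, map_sum, map_smul, LinearMap.sub_apply, LinearMap.sum_apply,
        LinearMap.smul_apply, hx, htS]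
      simp
    · intro j
      have ev := bT_even S K hS hK x (t j) hx (htS j)
      simp only [map_sub, map_sum, map_smul, LinearMap.sub_apply, LinearMap.sum_apply,
        LinearMap.smul_apply, h2, smul_eq_mul, mul_ite, mul_zero, Finset.sum_ite_eq',
        Finset.mem_univ, if_true]
      linear_combination -ev - (2 * (bLM x (t j) / 2)) * epsv_sq j
  have hht : ∀ i j, bLM (h i) (t j) = if i = j then epsv i else 0 := by
    intro i j
    have e1 := h2 i j
    rw [ht i, map_sub, map_smul, LinearMap.sub_apply, LinearMap.smul_apply, smul_eq_mul,
      bLM_symm (S i), htS] at e1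
    split_ifs at e1 ⊢ <;> omega
  have li : LinearIndependent ℤ (Sum.elim S h) := by
    rw [Fintype.linearIndependent_iff]
    intro g hg
    rw [Fintype.sum_sum_type] at hg
    simp only [Sum.elim_inl, Sum.elim_inr] at hg
    have hb : ∀ j, g (Sum.inr j) = 0 := by
      intro j
      have e1 := congrArg (fun x => bLM x (t j)) hg
      have e0 : ∀ i, bLM (S i) (t j) = 0 := fun i => by rw [bLM_symm, htS]
      simp only [map_add, map_sum, map_smul, LinearMap.add_apply, LinearMap.sum_apply,
        LinearMap.smul_apply, e0, hht, smul_eq_mul, mul_zero, Finset.sum_const_zero, zero_add,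
        mul_ite, Finset.sum_ite_eq', Finset.mem_univ, if_true, map_zero, LinearMap.zero_apply] at e1
      linear_combination epsv j * e1 - g (Sum.inr j) * epsv_sq j
    have ha : ∀ j, g (Sum.inl j) = 0 := by
      intro j
      simp only [hb, zero_smul, Finset.sum_const_zero, add_zero] at hg
      have e1 := congrArg (fun x => bLM (K j) x) hg
      have hK' : ∀ i j, bLM (K i) (S j) = if i = j then 1 else 0 := hK
      simp only [map_sum, map_smul, hK', smul_eq_mul, mul_ite, mul_one, mul_zero, map_zero,
        Finset.sum_ite_eq, Finset.mem_univ, if_true] at e1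
      exact e1
    rintro (j | j)
    · exact ha j
    · exact hb j
  have sp : ⊤ ≤ Submodule.span ℤ (Set.range (Sum.elim S h)) := by
    intro l _
    have mS : ∀ i, S i ∈ Submodule.span ℤ (Set.range (Sum.elim S h)) := fun i =>
      Submodule.subset_span ⟨Sum.inl i, rfl⟩
    have mh : ∀ i, h i ∈ Submodule.span ℤ (Set.range (Sum.elim S h)) := fun i =>
      Submodule.subset_span ⟨Sum.inr i, rfl⟩
    obtain ⟨v, hv⟩ : ∃ v : Fin 12 → ℤ, v ᵥ* GdM = fun k => bLM l (S k) :=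
      ⟨(fun k => bLM l (S k)) ᵥ* GdI, by rw [vecMul_vecMul, GdI_Gd, vecMul_one]⟩
    obtain ⟨c, hc⟩ := hspanT (l + ∑ i, v i • h i) (by
      intro j
      have hvj := congrFun hv j
      simp only [Matrix.vecMul, dotProduct] at hvj
      simp only [map_add, map_sum, map_smul, LinearMap.add_apply, LinearMap.sum_apply,
        LinearMap.smul_apply, h1, smul_eq_mul, mul_neg, Finset.sum_neg_distrib, hvj]
      ring)
    have : l = ∑ i, c i • t i - ∑ i, v i • h i := by rw [← hc]; abel
    rw [this]
    refine Submodule.sub_mem _ (Submodule.sum_mem _ fun i _ => Submodule.smul_mem _ _ ?_)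
      (Submodule.sum_mem _ fun i _ => Submodule.smul_mem _ _ (mh i))
    rw [ht]
    exact Submodule.sub_mem _ (Submodule.smul_mem _ _ (mh i)) (mS i)
  exact ⟨h, t, hS, h1, ht, htS, h2, hspanT, Basis.mk li sp, fun i => by rw [Basis.mk_apply]⟩

lemma part2 (ι₁ ι₂ : ↥D12plus →ₗ[ℤ] LM) (p1 : IsPrimD12Embedding ι₁)
    (p2 : IsPrimD12Embedding ι₂) :
      ∃ g : LM ≃ₗ[ℤ] LM, (∀ x y : LM, bLM (g x) (g y) = bLM x y) ∧
        ∀ s : ↥D12plus, g (ι₁ s) = ι₂ s := by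
  obtain ⟨h, t, hS, h1, ht, htS, h2, -, b, hb⟩ := struct_iota ι₁ p1
  obtain ⟨h', t', hS', h1', ht', htS', h2', -, b', hb'⟩ := struct_iota ι₂ p2
  have hbl : ∀ i, b (Sum.inl i) = ι₁ (bD i) := fun i => hb _
  have hbr : ∀ i, b (Sum.inr i) = h i := fun i => hb _
  have hbl' : ∀ i, b' (Sum.inl i) = ι₂ (bD i) := fun i => hb' _
  have hbr' : ∀ i, b' (Sum.inr i) = h' i := fun i => hb' _
  let g := b.equiv b' (Equiv.refl _)
  have hg : ∀ i, g (b i) = b' i := fun i => by simp [g]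
  have hh : ∀ (h t S : Fin 12 → LM), (∀ i j, bLM (S i) (S j) = -2 * GdM i j) →
      (∀ i j, bLM (h i) (S j) = - GdM i j) → (∀ i, t i = (2 : ℤ) • h i - S i) →
      ∀ i j, 4 * bLM (h i) (h j) = bLM (t i) (t j) - 2 * GdM j i := by
    intro h t S hS h1 ht i j
    simp only [ht, map_sub, map_smul, LinearMap.sub_apply, LinearMap.smul_apply, smul_eq_mul, hS, h1]
    rw [bLM_symm (S i) (h j), h1]
    ring
  refine ⟨g, ?_, ?_⟩
  · have key : bLM.compl₁₂ g.toLinearMap g.toLinearMap = bLM := by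
      refine b.ext fun i => b.ext fun j => ?_
      change bLM (g (b i)) (g (b j)) = bLM (b i) (b j)
      rw [hg, hg]
      rcases i with i | i <;> rcases j with j | j
      · rw [hbl, hbl, hbl', hbl', hS, hS']
      · rw [hbl, hbr, hbl', hbr', bLM_symm, h1', bLM_symm, h1]
      · rw [hbl, hbr, hbl', hbr', h1', h1]
      · rw [hbr, hbr, hbr', hbr']
        have e1 := hh h t _ hS h1 ht i j
        have e2 := hh h' t' _ hS' h1' ht' i j
        rw [h2] at e1
        rw [h2'] at e2
        linarith
    intro x y
    exact LinearMap.congr_fun (LinearMap.congr_fun key x) y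
  · have key : g.toLinearMap ∘ₗ ι₁ = ι₂ := by
      refine bD.ext fun i => ?_
      change g (ι₁ (bD i)) = _
      rw [← hbl, hg, hbl']
    intro s
    exact LinearMap.congr_fun key s

lemma part3 (ι : ↥D12plus →ₗ[ℤ] LM) (hp : IsPrimD12Embedding ι) :
      ∃ e : ↥(orthSub bLM (LinearMap.range ι)) ≃ₗ[ℤ] (T0Ix → ℤ),
        ∀ x y : ↥(orthSub bLM (LinearMap.range ι)),
          bLM (x : LM) (y : LM) = (e x) ⬝ᵥ (GT0 *ᵥ (e y)) := by
  obtain ⟨h, t, hS, h1, ht, htS, h2, hsp, -⟩ := struct_iota ι hp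
  let T := orthSub bLM (LinearMap.range ι)
  have htm : ∀ i, t i ∈ T := by
    rintro i _ ⟨s, rfl⟩
    have key : (bLM (t i)) ∘ₗ ι = 0 := bD.ext fun j => htS i j
    exact LinearMap.congr_fun key s
  let tT : Fin 12 → T := fun i => ⟨t i, htm i⟩
  have li : LinearIndependent ℤ tT := by
    rw [Fintype.linearIndependent_iff]
    intro g hg j
    have e1 := congrArg (fun x : T => bLM (x : LM) (t j)) hg
    simp only [Submodule.coe_sum, Submodule.coe_smul, map_sum, map_smul, LinearMap.sum_apply,
      LinearMap.smul_apply, tT, h2, smul_eq_mul, mul_ite, mul_zero, Finset.sum_ite_eq',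
      Finset.mem_univ, if_true, Submodule.coe_zero, map_zero, LinearMap.zero_apply] at e1
    have e2 := epsv_sq j
    have e3 : 2 * g j = 0 := by linear_combination epsv j * e1 - 2 * g j * e2
    omega
  have sp : ⊤ ≤ Submodule.span ℤ (Set.range tT) := by
    rintro ⟨x, hx⟩ -
    obtain ⟨c, hc⟩ := hsp x (fun j => hx _ ⟨_, rfl⟩)
    have : (⟨x, hx⟩ : T) = ∑ i, c i • tT i := by
      apply Subtype.ext
      simp only [Submodule.coe_sum, Submodule.coe_smul, tT]
      exact hc
    rw [this]
    exact Submodule.sum_mem _ fun i _ => Submodule.smul_mem _ _ (Submodule.subset_span ⟨i, rfl⟩)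
  let bT : Basis (Fin 12) ℤ T := Basis.mk li sp
  have hbT : ∀ i, bT i = tT i := fun i => by simp [bT]
  have hPQ : P0ᵀ * Q0ᵀ = 1 := by rw [← Matrix.transpose_mul, Q0_P0, Matrix.transpose_one]
  have hQP : Q0ᵀ * P0ᵀ = 1 := by rw [← Matrix.transpose_mul, P0_Q0, Matrix.transpose_one]
  let e0 : (Fin 12 → ℤ) ≃ₗ[ℤ] (T0Ix → ℤ) := Matrix.toLin'OfInv hPQ hQP
  have he0 : ∀ v, e0 v = Q0ᵀ *ᵥ v := fun v => rfl
  refine ⟨bT.equivFun ≪≫ₗ e0, ?_⟩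
  have he : ∀ i, (bT.equivFun ≪≫ₗ e0) (bT i) = Q0 i := by
    intro i
    rw [LinearEquiv.trans_apply, he0]
    funext p
    simp only [mulVec, dotProduct, Matrix.transpose_apply, Basis.equivFun_self]
    simp
  have hQ : Q0 * GT0 * Q0ᵀ = Matrix.diagonal (fun i => 2 * epsv i) := by
    rw [← P0_gram, ← Matrix.mul_assoc, ← Matrix.mul_assoc, Q0_P0, Matrix.one_mul,
      Matrix.mul_assoc, hPQ, Matrix.mul_one]
  have key : bLM.compl₁₂ T.subtype T.subtype =
      (gramBilin GT0).compl₁₂ (bT.equivFun ≪≫ₗ e0).toLinearMap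
        (bT.equivFun ≪≫ₗ e0).toLinearMap := by
    refine bT.ext fun i => bT.ext fun j => ?_
    change bLM (bT i : LM) (bT j : LM) =
      ((bT.equivFun ≪≫ₗ e0) (bT i)) ⬝ᵥ (GT0 *ᵥ ((bT.equivFun ≪≫ₗ e0) (bT j)))
    rw [he, he, hbT, hbT]
    change bLM (t i) (t j) = _
    have h3 := congrFun (congrFun hQ i) j
    rw [Matrix.diagonal_apply, Matrix.mul_assoc] at h3
    rw [h2, ← h3]
    simp only [dotProduct, mulVec, Matrix.mul_apply, Matrix.transpose_apply]
  intro x y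
  exact LinearMap.congr_fun (LinearMap.congr_fun key x) y

/-- up to isometries of `L_M` there is exactly one primitive embedding of
`D12^+(-2)` into the Mukai lattice, and the orthogonal complement of its image is
isometric to `U(2)^4 ⊕ ⟨-2⟩^4`. -/
theorem stmt9 :
    (∃ ι : ↥D12plus →ₗ[ℤ] LM, IsPrimD12Embedding ι) ∧
    (∀ ι₁ ι₂ : ↥D12plus →ₗ[ℤ] LM, IsPrimD12Embedding ι₁ → IsPrimD12Embedding ι₂ →
      ∃ g : LM ≃ₗ[ℤ] LM, (∀ x y : LM, bLM (g x) (g y) = bLM x y) ∧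
        ∀ s : ↥D12plus, g (ι₁ s) = ι₂ s) ∧
    (∀ ι : ↥D12plus →ₗ[ℤ] LM, IsPrimD12Embedding ι →
      ∃ e : ↥(orthSub bLM (LinearMap.range ι)) ≃ₗ[ℤ] (T0Ix → ℤ),
        ∀ x y : ↥(orthSub bLM (LinearMap.range ι)),
          bLM (x : LM) (y : LM) = (e x) ⬝ᵥ (GT0 *ᵥ (e y))) := by
  exact ⟨part1, part2, part3⟩
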